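/- arXiv:2605.16502 — 3 statements merged into one kernel-verified Lean document; each statement's English description precedes it below -/
import Mathlib

section
/- Let T_0 > 0 and let u in L^infty((0,T_0) x R^3; R^3) be divergence-free in the sense of distributions. Let Y : R^3 x [0,T_0] -> R^3 satisfy: (i) for every a in R^3 the map t -> Y(a,t) is absolutely continuous with Y(a,0) = a and d/dt Y(a,t) = u(Y(a,t), t) for almost every t; (ii) for every t in [0,T_0] the map Y_t := Y(.,t) is a measure-preserving homeomorphism of R^3 onto itself; (iii) there exists gamma in (0,1] such that for every compact K subset of R^3, sup_{t in [0,T_0]} ([Y_t]_{C^gamma(K)} + [Y_t^{-1}]_{C^gamma(K)}) < infty. Let xi_0 in L^1(R^3), and let xi in L^1_loc([0,T_0) x R^3) with u xi in L^1_loc([0,T_0) x R^3) satisfy the distributional transport identity: for every psi in C_c^infty(R^3 x [0,T_0)), Integral_0^{T_0} Integral_{R^3} xi(x,t)(d/dt psi(x,t) + u(x,t) . grad_x psi(x,t)) dx dt + Integral_{R^3} xi_0(x) psi(x,0) dx = 0. Assume furthermore there is a constant C_u > 0 with |u(x,t) - u(y,t)| <= C_u |x-y| log(2 + 1/|x-y|)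 for all x,y in R^3 and almost every t in (0,T_0). Then xi(x,t) = xi_0(Y_t^{-1}(x)) for almost every (x,t) in R^3 x (0,T_0). -/
noncomputable section

open MeasureTheory Real Set Filter
open scoped ENNReal

/-- Euclidean three-space. -/
abbrev E3 : Type := EuclideanSpace ℝ (Fin 3)


open Topology Convolution in
lemma exists_smooth_approx {M : ℝ} (v : ℝ → E3) (hv : Measurable v) (hvb : ∀ t, ‖v t‖ ≤ M) :
    ∃ w : ℕ → ℝ → E3, (∀ n, ContDiff ℝ (⊤ : ℕ∞) (w n)) ∧ (∀ n t, ‖w n t‖ ≤ M) ∧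
      ∀ᵐ t : ℝ, Tendsto (fun n => w n t) atTop (𝓝 (v t)) := by
  have hM : 0 ≤ M := (norm_nonneg _).trans (hvb 0)
  have hvl : LocallyIntegrable v volume := by
    intro x
    refine ⟨Metric.ball x 1, Metric.ball_mem_nhds x one_pos, ?_⟩
    exact Measure.integrableOn_of_bounded (M := M) measure_ball_lt_top.ne
      hv.aestronglyMeasurable (ae_of_all _ hvb)
  let φ : ℕ → ContDiffBump (0 : ℝ) := fun n =>
    ⟨1 / ((n : ℝ) + 1), 2 * (1 / ((n : ℝ) + 1)), by positivity, by
      have : 0 < 1 / ((n : ℝ) + 1) := by positivity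
      linarith⟩
  have hφ : Tendsto (fun i ↦ (φ i).rOut) atTop (𝓝 0) := by
    have := (tendsto_one_div_add_atTop_nhds_zero_nat (𝕜 := ℝ)).const_mul 2
    rw [mul_zero] at this
    exact this
  refine ⟨fun n => ((φ n).normed volume ⋆[ContinuousLinearMap.lsmul ℝ ℝ, volume] v), ?_, ?_, ?_⟩
  · intro n
    exact (φ n).hasCompactSupport_normed.contDiff_convolution_left _ (φ n).contDiff_normed hvl
  · intro n t
    have h1 : Integrable ((φ n).normed volume) volume := (φ n).integrable_normed
    calc ‖((φ n).normed volume ⋆[ContinuousLinearMap.lsmul ℝ ℝ, volume] v) t‖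
        ≤ ∫ s, (φ n).normed volume s * M := by
          apply norm_integral_le_of_norm_le (h1.mul_const M)
          refine ae_of_all _ fun s => ?_
          simp only [ContinuousLinearMap.lsmul_apply, norm_smul]
          rw [Real.norm_of_nonneg ((φ n).nonneg_normed s)]
          exact mul_le_mul_of_nonneg_left (hvb _) ((φ n).nonneg_normed s)
      _ = M := by rw [integral_mul_const, (φ n).integral_normed, one_mul]
  · exact ContDiffBump.ae_convolution_tendsto_right_of_locallyIntegrable hφ
      (Eventually.of_forall fun n => le_refl _) hvl

lemma contDiff_primitive (w : ℝ → E3) (hw : ContDiff ℝ (⊤ : ℕ∞) w) (a : E3) :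
    ContDiff ℝ (⊤ : ℕ∞) (fun t => a + ∫ s in (0:ℝ)..t, w s) ∧
    ∀ t, HasDerivAt (fun t => a + ∫ s in (0:ℝ)..t, w s) (w t) t := by
  have h : ∀ t, HasDerivAt (fun t => a + ∫ s in (0:ℝ)..t, w s) (w t) t := fun t =>
    (intervalIntegral.integral_hasDerivAt_right (hw.continuous.intervalIntegrable _ _)
      (hw.continuous.stronglyMeasurableAtFilter _ _) hw.continuous.continuousAt).const_add a
  refine ⟨?_, h⟩
  rw [contDiff_infty_iff_deriv]
  refine ⟨fun t => (h t).differentiableAt, ?_⟩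
  rwa [show deriv (fun t => a + ∫ s in (0:ℝ)..t, w s) = w from funext fun t => (h t).deriv]

lemma contDiff_primitive_real (c : ℝ) (w : ℝ → ℝ) (hw : ContDiff ℝ (⊤ : ℕ∞) w) :
    ContDiff ℝ (⊤ : ℕ∞) (fun t => ∫ s in c..t, w s) ∧
    ∀ t, HasDerivAt (fun t => ∫ s in c..t, w s) (w t) t := by
  have h : ∀ t, HasDerivAt (fun t => ∫ s in c..t, w s) (w t) t := fun t =>
    (intervalIntegral.integral_hasDerivAt_right (hw.continuous.intervalIntegrable _ _)
      (hw.continuous.stronglyMeasurableAtFilter _ _) hw.continuous.continuousAt)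
  refine ⟨?_, h⟩
  rw [contDiff_infty_iff_deriv]
  refine ⟨fun t => (h t).differentiableAt, ?_⟩
  rwa [show deriv (fun t => ∫ s in c..t, w s) = w from funext fun t => (h t).deriv]


lemma continuous_fderiv_pair (ρ : E3 → ℝ) (hρ : ContDiff ℝ (⊤ : ℕ∞) ρ) :
    Continuous (fun q : E3 × E3 => fderiv ℝ ρ q.1 q.2) := by
  have h : Continuous (fderiv ℝ ρ) := hρ.continuous_fderiv (by simp)
  exact (h.comp continuous_fst).clm_apply continuous_snd

open Topology in
lemma path_identity (T0 : ℝ) {M : ℝ} (u : E3 → ℝ → E3)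
    (hum : Measurable (fun p : E3 × ℝ => u p.1 p.2)) (hub : ∀ x t, ‖u x t‖ ≤ M)
    (ξ₀ : E3 → ℝ) (ξ : E3 → ℝ → ℝ)
    (hξloc : LocallyIntegrableOn (fun p : E3 × ℝ => ξ p.1 p.2)
      ((univ : Set E3) ×ˢ Ico 0 T0) volume)
    (htransport : ∀ ψ : E3 × ℝ → ℝ, ContDiff ℝ (⊤ : ℕ∞) ψ → HasCompactSupport ψ →
      tsupport ψ ⊆ (univ : Set E3) ×ˢ Iio T0 →
      (∫ p : E3 × ℝ in (univ : Set E3) ×ˢ Ioo 0 T0,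
          ξ p.1 p.2 *
            (deriv (fun s => ψ (p.1, s)) p.2 +
              fderiv ℝ (fun y => ψ (y, p.2)) p.1 (u p.1 p.2)))
        + (∫ x : E3, ξ₀ x * ψ (x, 0)) = 0)
    (v : ℝ → E3) (hv : Measurable v) (hvb : ∀ t, ‖v t‖ ≤ M)
    (y : ℝ → E3) (y0 : E3) (hy : ∀ t, y t = y0 + ∫ s in (0:ℝ)..t, v s)
    (χ : ℝ → ℝ) (hχ : ContDiff ℝ (⊤ : ℕ∞) χ) (hχc : HasCompactSupport χ)
    (hχT : tsupport χ ⊆ Iio T0)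
    (ρ : E3 → ℝ) (hρ : ContDiff ℝ (⊤ : ℕ∞) ρ) (hρc : HasCompactSupport ρ) :
    (∫ p : E3 × ℝ in (univ : Set E3) ×ˢ Ioo 0 T0,
      ξ p.1 p.2 * (deriv χ p.2 * ρ (p.1 - y p.2)
        + χ p.2 * fderiv ℝ ρ (p.1 - y p.2) (u p.1 p.2 - v p.2)))
      + ∫ x : E3, ξ₀ x * (χ 0 * ρ (x - y0)) = 0 := by
  have hM : 0 ≤ M := (norm_nonneg _).trans (hvb 0)
  obtain ⟨w, hws, hwb, hwt⟩ := exists_smooth_approx v hv hvb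
  set g : ℕ → ℝ → E3 := fun n t => y0 + ∫ s in (0:ℝ)..t, w n s with hg
  have hgs : ∀ n, ContDiff ℝ (⊤ : ℕ∞) (g n) := fun n => (contDiff_primitive (w n) (hws n) y0).1
  have hgd : ∀ n t, HasDerivAt (g n) (w n t) t :=
    fun n => (contDiff_primitive (w n) (hws n) y0).2
  have hgb : ∀ n t, ‖g n t‖ ≤ ‖y0‖ + M * |t| := by
    intro n t
    refine (norm_add_le _ _).trans ?_
    gcongr
    have := intervalIntegral.norm_integral_le_of_norm_le_const (a := 0) (b := t)
      (f := w n) (C := M) (fun s _ => hwb n s)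
    simpa using this
  have hg0 : ∀ n, g n 0 = y0 := fun n => by simp [hg]
  have hgt : ∀ t, Tendsto (fun n => g n t) atTop (𝓝 (y t)) := by
    intro t
    rw [hy t]
    apply Tendsto.const_add
    apply intervalIntegral.tendsto_integral_filter_of_dominated_convergence (fun _ => M)
    · exact Eventually.of_forall fun n => (hws n).continuous.aestronglyMeasurable
    · exact Eventually.of_forall fun n => ae_of_all _ fun s _ => hwb n s
    · simp
    · filter_upwards [hwt] with s hs _ using hs
  -- radii
  obtain ⟨R1, hR1⟩ := hχc.isCompact.isBounded.subset_closedBall 0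
  obtain ⟨R2, hR2⟩ := hρc.isCompact.isBounded.subset_closedBall 0
  have hR1' : ∀ t ∈ tsupport χ, |t| ≤ R1 := fun t ht => by simpa using hR1 ht
  have hR2' : ∀ z ∈ tsupport ρ, ‖z‖ ≤ R2 := fun t ht => by simpa using hR2 ht
  set R := ‖y0‖ + M * R1 + R2 with hR
  have hdχ : ∀ t, t ∉ tsupport χ → deriv χ t = 0 := fun t ht =>
    image_eq_zero_of_notMem_tsupport (fun h => ht (tsupport_deriv_subset h))
  have hdρ : ∀ z, z ∉ tsupport ρ → fderiv ℝ ρ z = 0 := fun t ht =>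
    image_eq_zero_of_notMem_tsupport (fun h => ht (tsupport_fderiv_subset ℝ h))
  have hχ0 : ∀ t, t ∉ tsupport χ → χ t = 0 := fun t ht => image_eq_zero_of_notMem_tsupport ht
  have hρ0 : ∀ t, t ∉ tsupport ρ → ρ t = 0 := fun t ht => image_eq_zero_of_notMem_tsupport ht
  have hdχcont : Continuous (deriv χ) := hχ.continuous_deriv (by simp)
  have hdρcont : Continuous (fderiv ℝ ρ) := hρ.continuous_fderiv (by simp)
  -- big x
  have hfar : ∀ n (x : E3) t, t ∈ tsupport χ → R < ‖x‖ → x - g n t ∉ tsupport ρ := by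
    intro n x t ht hx hmem
    have h1 := hR2' _ hmem
    have h2 := hgb n t
    have h3 := hR1' t ht
    have h4 : ‖x‖ ≤ ‖x - g n t‖ + ‖g n t‖ := by
      simpa using norm_add_le (x - g n t) (g n t)
    have h5 : M * |t| ≤ M * R1 := by gcongr
    linarith
  set Q : Set (E3 × ℝ) := Metric.closedBall 0 R ×ˢ (tsupport χ ∩ Ici 0) with hQ
  have hQc : IsCompact Q :=
    (isCompact_closedBall _ _).prod (hχc.isCompact.inter_right isClosed_Ici)
  have hQs : Q ⊆ (univ : Set E3) ×ˢ Ico 0 T0 := by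
    rintro ⟨x, t⟩ ⟨_, h2, h3⟩
    exact ⟨trivial, h3, hχT h2⟩
  have hξQ : IntegrableOn (fun p : E3 × ℝ => ξ p.1 p.2) Q volume :=
    hξloc.integrableOn_compact_subset hQs hQc
  have hξm : AEStronglyMeasurable (fun p : E3 × ℝ => ξ p.1 p.2)
      (volume.restrict ((univ : Set E3) ×ˢ Ioo 0 T0)) :=
    hξloc.aestronglyMeasurable.mono_measure
      (Measure.restrict_mono (Set.prod_mono le_rfl Ioo_subset_Ico_self) le_rfl)
  -- constants
  obtain ⟨C1, hC1⟩ := hχc.deriv.exists_bound_of_continuous hdχcont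
  obtain ⟨C2, hC2⟩ := hχc.exists_bound_of_continuous hχ.continuous
  obtain ⟨C3, hC3⟩ := hρc.exists_bound_of_continuous hρ.continuous
  obtain ⟨C4, hC4⟩ := (hρc.fderiv ℝ).exists_bound_of_continuous hdρcont
  have hC1p : 0 ≤ C1 := (norm_nonneg _).trans (hC1 0)
  have hC2p : 0 ≤ C2 := (norm_nonneg _).trans (hC2 0)
  have hC3p : 0 ≤ C3 := (norm_nonneg _).trans (hC3 0)
  have hC4p : 0 ≤ C4 := (norm_nonneg _).trans (hC4 0)
  set C := C1 * C3 + C2 * (C4 * (M + M)) with hC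
  have hDcont := continuous_fderiv_pair ρ hρ
  let F : ℕ → E3 × ℝ → ℝ := fun n p => ξ p.1 p.2 * (deriv χ p.2 * ρ (p.1 - g n p.2)
        + χ p.2 * fderiv ℝ ρ (p.1 - g n p.2) (u p.1 p.2 - w n p.2))
  -- identity for each n
  have hn : ∀ n, (∫ p : E3 × ℝ in (univ : Set E3) ×ˢ Ioo 0 T0, F n p)
      + ∫ x : E3, ξ₀ x * (χ 0 * ρ (x - y0)) = 0 := by
    intro n
    let ψ : E3 × ℝ → ℝ := fun p => χ p.2 * ρ (p.1 - g n p.2)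
    have hψs : ContDiff ℝ (⊤ : ℕ∞) ψ :=
      (hχ.comp contDiff_snd).mul (hρ.comp (contDiff_fst.sub ((hgs n).comp contDiff_snd)))
    have hψc : HasCompactSupport ψ := by
      apply HasCompactSupport.intro (K := Metric.closedBall 0 R ×ˢ tsupport χ)
        ((isCompact_closedBall _ _).prod hχc.isCompact)
      rintro ⟨x, t⟩ hp
      by_cases ht : t ∈ tsupport χ
      · have hx : R < ‖x‖ := by
          by_contra hx
          exact hp ⟨by simpa using hx, ht⟩
        simp [ψ, hρ0 _ (hfar n x t ht hx)]
      · simp [ψ, hχ0 t ht]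
    have hψT : tsupport ψ ⊆ (univ : Set E3) ×ˢ Iio T0 := by
      have h1 : tsupport ψ ⊆ (univ : Set E3) ×ˢ tsupport χ := by
        apply closure_minimal _ (isClosed_univ.prod (isClosed_tsupport χ))
        rintro ⟨x, t⟩ hp
        refine ⟨trivial, ?_⟩
        by_contra ht
        exact hp (by simp [ψ, hχ0 t ht])
      exact h1.trans (Set.prod_mono le_rfl hχT)
    have := htransport ψ hψs hψc hψT
    refine Eq.trans ?_ this
    congr 1
    · apply integral_congr_ae
      refine ae_of_all _ fun p => ?_
      obtain ⟨x, t⟩ := p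
      simp only [F]
      congr 1
      have hd1 : HasDerivAt (fun s => x - g n s) (-(w n t)) t := by
        simpa using (hgd n t).const_sub x
      have hd2 : HasDerivAt (fun s => ρ (x - g n s)) (fderiv ℝ ρ (x - g n t) (-(w n t))) t :=
        ((hρ.differentiable (by simp)) (x - g n t)).hasFDerivAt.comp_hasDerivAt t hd1
      have hd3 : HasDerivAt (fun s => ψ (x, s))
          (deriv χ t * ρ (x - g n t) + χ t * (fderiv ℝ ρ (x - g n t) (-(w n t)))) t :=
        ((hχ.differentiable (by simp)) t).hasDerivAt.mul hd2
      have hd4 : HasFDerivAt (fun z => ψ (z, t)) (χ t • fderiv ℝ ρ (x - g n t)) x := by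
        have h1 : HasFDerivAt (fun z : E3 => z - g n t) (ContinuousLinearMap.id ℝ E3) x :=
          (hasFDerivAt_id x).sub_const _
        have h2 := (((hρ.differentiable (by simp)) (x - g n t)).hasFDerivAt.comp x h1).const_mul
          (χ t)
        simpa using h2
      rw [hd3.deriv, hd4.fderiv]
      simp only [map_neg, map_sub, smul_apply, smul_eq_mul]
      ring
    · simp [ψ, hg0]
  have hlim : Tendsto (fun n => ∫ p : E3 × ℝ in (univ : Set E3) ×ˢ Ioo 0 T0, F n p) atTop
      (𝓝 (∫ p : E3 × ℝ in (univ : Set E3) ×ˢ Ioo 0 T0,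
      ξ p.1 p.2 * (deriv χ p.2 * ρ (p.1 - y p.2)
        + χ p.2 * fderiv ℝ ρ (p.1 - y p.2) (u p.1 p.2 - v p.2)))) := by
    apply tendsto_integral_of_dominated_convergence
      (fun p => ‖Q.indicator (fun p : E3 × ℝ => ξ p.1 p.2) p‖ * C)
    · intro n
      refine hξm.mul (Measurable.aestronglyMeasurable ?_)
      have m1 : Measurable (fun p : E3 × ℝ => p.1 - g n p.2) :=
        measurable_fst.sub ((hgs n).continuous.measurable.comp measurable_snd)
      have m2 : Measurable (fun p : E3 × ℝ => u p.1 p.2 - w n p.2) :=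
        hum.sub ((hws n).continuous.measurable.comp measurable_snd)
      exact ((hdχcont.measurable.comp measurable_snd).mul (hρ.continuous.measurable.comp m1)).add
        ((hχ.continuous.measurable.comp measurable_snd).mul
          (hDcont.measurable.comp (m1.prodMk m2)))
    · have : Integrable (Q.indicator (fun p : E3 × ℝ => ξ p.1 p.2)) volume :=
        (integrable_indicator_iff hQc.measurableSet).2 hξQ
      exact (this.norm.mul_const C).integrableOn
    · intro n
      refine (ae_restrict_iff' (MeasurableSet.univ.prod measurableSet_Ioo)).2 (ae_of_all _ ?_)
      rintro ⟨x, t⟩ ⟨_, ht0⟩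
      simp only at ht0
      by_cases hp : (x, t) ∈ Q
      · rw [indicator_of_mem hp]
        simp only [F, norm_mul]
        refine mul_le_mul_of_nonneg_left ?_ (norm_nonneg _)
        refine (norm_add_le _ _).trans ?_
        rw [norm_mul, norm_mul, hC]
        gcongr
        · exact hC1 _
        · exact hC3 _
        · exact hC2 _
        · refine (ContinuousLinearMap.le_opNorm _ _).trans ?_
          gcongr
          · exact hC4 _
          · exact (norm_sub_le _ _).trans (add_le_add (hub _ _) (hwb _ _))
      · rw [indicator_of_notMem hp]
        simp only [F, norm_zero, zero_mul]
        by_cases ht : t ∈ tsupport χ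
        · have hx : R < ‖x‖ := by
            by_contra hx
            exact hp ⟨by simpa using hx, ht, ht0.1.le⟩
          simp [hρ0 _ (hfar n x t ht hx), hdρ _ (hfar n x t ht hx)]
        · simp [hχ0 t ht, hdχ t ht]
    · have h1 : ∀ᵐ p : E3 × ℝ, Tendsto (fun n => w n p.2) atTop (𝓝 (v p.2)) :=
        Measure.quasiMeasurePreserving_snd.ae hwt
      filter_upwards [ae_restrict_of_ae h1] with p hp
      apply Tendsto.const_mul
      have h2 : Tendsto (fun n => p.1 - g n p.2) atTop (𝓝 (p.1 - y p.2)) :=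
        (hgt p.2).const_sub _
      have h3 : Tendsto (fun n => u p.1 p.2 - w n p.2) atTop (𝓝 (u p.1 p.2 - v p.2)) :=
        hp.const_sub _
      refine (((hρ.continuous.tendsto _).comp h2).const_mul _).add (Tendsto.const_mul _ ?_)
      exact (hDcont.tendsto (p.1 - y p.2, u p.1 p.2 - v p.2)).comp (h2.prodMk_nhds h3)
  have h0 : Tendsto (fun n => (∫ p : E3 × ℝ in (univ : Set E3) ×ˢ Ioo 0 T0, F n p)
      + ∫ x : E3, ξ₀ x * (χ 0 * ρ (x - y0))) atTop (𝓝 0) := by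
    simp only [hn]; exact tendsto_const_nhds
  exact tendsto_nhds_unique (hlim.add_const _) h0


lemma exists_mollifier : ∃ B : ℝ, 0 ≤ B ∧ ∀ ε : ℝ, 0 < ε → ∃ ρ : E3 → ℝ,
    ContDiff ℝ (⊤ : ℕ∞) ρ ∧ HasCompactSupport ρ ∧ (∀ z, 0 ≤ ρ z) ∧ ∫ z, ρ z = 1 ∧
    (∀ z, ε < ‖z‖ → ρ z = 0) ∧ (∀ z, ε < ‖z‖ → fderiv ℝ ρ z = 0) ∧
    ∫ z, ‖fderiv ℝ ρ z‖ ≤ B / ε := by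
  let φ : ContDiffBump (0 : E3) := ⟨1 / 2, 1, by norm_num, by norm_num⟩
  set f : E3 → ℝ := φ.normed volume with hf
  have hfs : ContDiff ℝ (⊤ : ℕ∞) f := φ.contDiff_normed
  refine ⟨∫ z, ‖fderiv ℝ f z‖, integral_nonneg fun _ => norm_nonneg _, fun ε hε => ?_⟩
  have hf0 : ∀ z, 1 < ‖z‖ → f z = 0 := by
    intro z hz
    have : z ∉ Function.support f := by
      rw [hf, φ.support_normed_eq]
      simp only [Metric.mem_ball, dist_zero_right, not_lt]
      exact hz.le
    simpa using this
  let ρ : E3 → ℝ := fun z => ε⁻¹ ^ 3 * f (ε⁻¹ • z)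
  have hρs : ContDiff ℝ (⊤ : ℕ∞) ρ :=
    contDiff_const.mul (hfs.comp (contDiff_id.const_smul ε⁻¹))
  have hρ0 : ∀ z, ε < ‖z‖ → ρ z = 0 := by
    intro z hz
    have : f (ε⁻¹ • z) = 0 := by
      apply hf0
      rw [norm_smul, norm_inv, Real.norm_of_nonneg hε.le]
      rw [inv_mul_eq_div, one_lt_div hε]
      exact hz
    simp [ρ, this]
  have hfin : Module.finrank ℝ E3 = 3 := by simp
  have hint : ∀ g : E3 → ℝ, ∫ z, g (ε⁻¹ • z) = ε ^ 3 * ∫ z, g z := by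
    intro g
    rw [Measure.integral_comp_smul, hfin, smul_eq_mul]
    rw [abs_of_pos (by positivity)]
    congr 1
    field_simp
  refine ⟨ρ, hρs, ?_, ?_, ?_, hρ0, ?_, ?_⟩
  · apply HasCompactSupport.intro (isCompact_closedBall (0 : E3) ε)
    intro z hz
    exact hρ0 z (by simpa using hz)
  · intro z
    exact mul_nonneg (by positivity) (φ.nonneg_normed _)
  · simp only [ρ]
    rw [integral_const_mul, hint, φ.integral_normed]
    field_simp
  · intro z hz
    have : ρ =ᶠ[nhds z] fun _ => 0 := by
      have ho : IsOpen {z : E3 | ε < ‖z‖} := isOpen_lt continuous_const continuous_norm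
      filter_upwards [ho.mem_nhds hz] with w hw using hρ0 w hw
    rw [this.fderiv_eq]
    simp
  · have hd : ∀ z, ‖fderiv ℝ ρ z‖ = ε⁻¹ ^ 4 * ‖fderiv ℝ f (ε⁻¹ • z)‖ := by
      intro z
      have h1 : HasFDerivAt (fun z : E3 => ε⁻¹ • z) (ε⁻¹ • ContinuousLinearMap.id ℝ E3) z :=
        (hasFDerivAt_id z).const_smul ε⁻¹
      have h2 := (((hfs.differentiable (by simp)) (ε⁻¹ • z)).hasFDerivAt.comp z h1).const_mul
          (ε⁻¹ ^ 3)
      have h3 : HasFDerivAt ρ (ε⁻¹ ^ 4 • fderiv ℝ f (ε⁻¹ • z)) z := by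
        refine HasFDerivAt.congr_fderiv (f := ρ) h2 (ContinuousLinearMap.ext fun w => ?_)
        simp only [smul_apply, smul_eq_mul, ContinuousLinearMap.comp_apply,
          ContinuousLinearMap.id_apply, map_smul]
        ring
      rw [h3.fderiv, norm_smul, Real.norm_of_nonneg (by positivity)]
    simp only [hd]
    rw [integral_const_mul, hint (fun z => ‖fderiv ℝ f z‖)]
    apply le_of_eq
    field_simp

lemma mollify_est1 {ε δ : ℝ} (ρ : E3 → ℝ) (hρs : ContDiff ℝ (⊤ : ℕ∞) ρ)
    (hρc : HasCompactSupport ρ) (hρn : ∀ z, 0 ≤ ρ z) (hρi : ∫ z, ρ z = 1)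
    (hρ0 : ∀ z, ε < ‖z‖ → ρ z = 0) (h : E3 → ℝ) (hc : Continuous h) (x : E3)
    (hδ : ∀ y, ‖x - y‖ ≤ ε → |h y - h x| ≤ δ) :
    |(∫ y, h y * ρ (x - y)) - h x| ≤ δ := by
  have hint : ∀ k : E3 → ℝ, Continuous k → Integrable (fun y => k y * ρ (x - y)) volume := by
    intro k hk
    apply Continuous.integrable_of_hasCompactSupport
    · exact hk.mul (hρs.continuous.comp (continuous_const.sub continuous_id))
    · exact (hρc.comp_homeomorph (Homeomorph.subLeft x)).mul_left
  have h1 : ∫ y, ρ (x - y) = 1 := by rw [integral_sub_left_eq_self ρ volume x, hρi]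
  have h2 : (∫ y, h y * ρ (x - y)) - h x = ∫ y, (h y - h x) * ρ (x - y) := by
    simp only [sub_mul]
    rw [integral_sub (hint h hc) (hint (fun _ => h x) continuous_const), integral_const_mul, h1,
      mul_one]
  rw [h2, ← Real.norm_eq_abs]
  have h3 : ∫ y, δ * ρ (x - y) = δ := by rw [integral_const_mul, h1, mul_one]
  rw [← h3]
  apply norm_integral_le_of_norm_le (hint (fun _ => δ) continuous_const)
  refine ae_of_all _ fun y => ?_
  rw [norm_mul, Real.norm_of_nonneg (hρn _)]
  by_cases hy : ‖x - y‖ ≤ ε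
  · exact mul_le_mul_of_nonneg_right (hδ y hy) (hρn _)
  · simp [hρ0 _ (not_le.1 hy)]

lemma integrable_Dρ (ρ : E3 → ℝ) (hρs : ContDiff ℝ (⊤ : ℕ∞) ρ)
    (hρc : HasCompactSupport ρ) (h : E3 → ℝ) (hc : Continuous h) (x : E3)
    (k : E3 → E3) (hk : Continuous k) :
    Integrable (fun y => h y * fderiv ℝ ρ (x - y) (k y)) volume := by
  apply Continuous.integrable_of_hasCompactSupport
  · refine hc.mul ((continuous_fderiv_pair ρ hρs).comp
      ((continuous_const.sub continuous_id).prodMk hk))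
  · have h1 : HasCompactSupport (fun y => fderiv ℝ ρ (x - y)) :=
      (hρc.fderiv ℝ).comp_homeomorph (Homeomorph.subLeft x)
    refine h1.mono ?_
    intro y hy hy'
    apply hy
    simp only at hy'
    simp [hy']

lemma mollify_est2 {ε δ ω b : ℝ} (hω0 : 0 ≤ ω) (hδ0 : 0 ≤ δ)
    (ρ : E3 → ℝ) (hρs : ContDiff ℝ (⊤ : ℕ∞) ρ)
    (hρc : HasCompactSupport ρ) 
    (hρ0 : ∀ z, ε < ‖z‖ → fderiv ℝ ρ z = 0) (hb : ∫ z, ‖fderiv ℝ ρ z‖ ≤ b)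
    (h : E3 → ℝ) (hc : Continuous h) (x : E3)
    (hδ : ∀ y, ‖x - y‖ ≤ ε → |h y - h x| ≤ δ)
    (u : E3 → E3) (hu : Continuous u) (hω : ∀ y, ‖x - y‖ ≤ ε → ‖u x - u y‖ ≤ ω)
    (h0 : ∫ y, fderiv ℝ ρ (x - y) (u x - u y) = 0) :
    |∫ y, h y * fderiv ℝ ρ (x - y) (u x - u y)| ≤ δ * ω * b := by
  have hk : Continuous fun y => u x - u y := continuous_const.sub hu
  have h2 : (∫ y, h y * fderiv ℝ ρ (x - y) (u x - u y))
      = ∫ y, (h y - h x) * fderiv ℝ ρ (x - y) (u x - u y) := by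
    simp only [sub_mul]
    rw [integral_sub (integrable_Dρ ρ hρs hρc h hc x _ hk)
      (integrable_Dρ ρ hρs hρc (fun _ => h x) continuous_const x _ hk), integral_const_mul, h0,
      mul_zero, sub_zero]
  rw [h2, ← Real.norm_eq_abs]
  have hdi : Integrable (fun z => ‖fderiv ℝ ρ z‖) volume :=
    ((hρs.continuous_fderiv (by simp)).integrable_of_hasCompactSupport (hρc.fderiv ℝ)).norm
  have h3 : ∫ y, (δ * ω) * ‖fderiv ℝ ρ (x - y)‖ ≤ δ * ω * b := by
    rw [integral_const_mul, integral_sub_left_eq_self (fun z => ‖fderiv ℝ ρ z‖) volume x]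
    gcongr
  refine le_trans ?_ h3
  apply norm_integral_le_of_norm_le ((hdi.comp_sub_left x).const_mul _)
  refine ae_of_all _ fun y => ?_
  by_cases hy : ‖x - y‖ ≤ ε
  · rw [norm_mul]
    have e1 := hδ y hy
    have e2 := (fderiv ℝ ρ (x - y)).le_opNorm (u x - u y)
    have e3 := hω y hy
    calc ‖h y - h x‖ * ‖fderiv ℝ ρ (x - y) (u x - u y)‖
        ≤ δ * (‖fderiv ℝ ρ (x - y)‖ * ω) := by
          refine mul_le_mul e1 (e2.trans ?_) (norm_nonneg _) hδ0
          gcongr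
      _ = _ := by ring
  · simp [hρ0 _ (not_le.1 hy)]


structure NiceFlow (T0 M γ Cω : ℝ) (u Y Yi : E3 → ℝ → E3) : Prop where
  hM : 0 ≤ M
  hγ : 0 < γ
  hγ1 : γ ≤ 1
  hum : Measurable (fun p : E3 × ℝ => u p.1 p.2)
  hub : ∀ x t, ‖u x t‖ ≤ M
  huc : ∀ t, Continuous fun x => u x t
  hCω : 0 ≤ Cω
  hω : ∀ t x y, ‖x - y‖ ≤ 1 → ‖u x t - u y t‖ ≤ Cω * ‖x - y‖ ^ (1 - γ / 2)
  hYc : Continuous (fun p : E3 × ℝ => Y p.1 p.2)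
  hYic : Continuous (fun p : E3 × ℝ => Yi p.1 p.2)
  hl : ∀ a t, Yi (Y a t) t = a
  hr : ∀ a t, Y (Yi a t) t = a
  hmp : ∀ t, MeasurePreserving (fun a => Y a t) volume volume
  hode : ∀ a t, Y a t = a + ∫ s in (0:ℝ)..t, u (Y a s) s
  hH : ∀ K : Set E3, IsCompact K → ∃ C : ℝ, 0 ≤ C ∧ ∀ t, ∀ x ∈ K, ∀ y ∈ K,
    ‖Yi x t - Yi y t‖ ≤ C * ‖x - y‖ ^ γ
  hdiv : ∀ ρ : E3 → ℝ, ContDiff ℝ (⊤ : ℕ∞) ρ → HasCompactSupport ρ →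
    ∀ᵐ t ∂(volume.restrict (Ioo 0 T0)), ∀ x, ∫ y, fderiv ℝ ρ (x - y) (u x t - u y t) = 0

namespace NiceFlow
variable {T0 M γ Cω : ℝ} {u Y Yi : E3 → ℝ → E3}

lemma Y0 (F : NiceFlow T0 M γ Cω u Y Yi) (a : E3) : Y a 0 = a := by
  rw [F.hode]; simp

lemma Yi0 (F : NiceFlow T0 M γ Cω u Y Yi) (a : E3) : Yi a 0 = a := by
  have := F.hl a 0
  rwa [F.Y0] at this

lemma norm_Y_le (F : NiceFlow T0 M γ Cω u Y Yi) (a : E3) {t : ℝ} (ht : t ∈ Icc 0 T0) :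
    ‖Y a t‖ ≤ ‖a‖ + M * T0 := by
  rw [F.hode]
  refine (norm_add_le _ _).trans ?_
  gcongr
  have := intervalIntegral.norm_integral_le_of_norm_le_const (a := 0) (b := t)
      (f := fun s => u (Y a s) s) (C := M) (fun s _ => F.hub _ s)
  refine this.trans ?_
  have := F.hM
  rw [sub_zero, abs_of_nonneg ht.1]
  exact mul_le_mul_of_nonneg_left ht.2 F.hM

lemma modulus (F : NiceFlow T0 M γ Cω u Y Yi) {R L C ε : ℝ} (hC0 : 0 ≤ C) (hL0 : 0 ≤ L)
    (hC : ∀ t, ∀ x ∈ Metric.closedBall (0 : E3) (R + M * T0 + 1),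
      ∀ y ∈ Metric.closedBall (0 : E3) (R + M * T0 + 1),
      ‖Yi x t - Yi y t‖ ≤ C * ‖x - y‖ ^ γ) (hε : ε ≤ 1) {t : ℝ} (ht : t ∈ Icc 0 T0)
    (f : E3 → ℝ) (hfL : ∀ a b, |f a - f b| ≤ L * ‖a - b‖) (hf0 : ∀ a, R < ‖a‖ → f a = 0)
    (x y : E3) (hxy : ‖x - y‖ ≤ ε) : |f (Yi y t) - f (Yi x t)| ≤ L * C * ε ^ γ := by
  have hε0 : 0 ≤ ε := (norm_nonneg _).trans hxy
  have key : ∀ z, f (Yi z t) ≠ 0 → ‖z‖ ≤ R + M * T0 := by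
    intro z hz
    have h1 : ‖Yi z t‖ ≤ R := by
      by_contra h
      exact hz (hf0 _ (not_le.1 h))
    have h2 := F.norm_Y_le (Yi z t) ht
    rw [F.hr] at h2
    linarith
  have tri : ‖x‖ ≤ ‖y‖ + 1 ∧ ‖y‖ ≤ ‖x‖ + 1 := by
    have h1 := norm_sub_norm_le x y
    have h2 := norm_sub_norm_le y x
    rw [norm_sub_rev] at h2
    constructor <;> linarith
  have main : ‖x‖ ≤ R + M * T0 + 1 → ‖y‖ ≤ R + M * T0 + 1 →
      |f (Yi y t) - f (Yi x t)| ≤ L * C * ε ^ γ := by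
    intro hx hy
    refine (hfL _ _).trans ?_
    rw [mul_assoc]
    gcongr
    have := hC t y (by simpa using hy) x (by simpa using hx)
    refine this.trans ?_
    gcongr
    · exact F.hγ.le
    · rwa [norm_sub_rev]
  by_cases h1 : f (Yi x t) = 0
  · by_cases h2 : f (Yi y t) = 0
    · rw [h1, h2]
      simp
      positivity
    · have := key y h2
      exact main (by linarith [tri.1]) (by linarith)
  · have := key x h1
    exact main (by linarith) (by linarith [tri.2])

/-- a family of test functions in Lagrangian variables -/
structure Test (T0 R L C T1 : ℝ) (χ g : E3 → ℝ → ℝ) : Prop where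
  hT1 : T1 < T0
  hL : 0 ≤ L
  hC : 0 ≤ C
  hs : ∀ a, ContDiff ℝ (⊤ : ℕ∞) (χ a)
  hcs : ∀ a, HasCompactSupport (χ a)
  hts : ∀ a, tsupport (χ a) ⊆ Iic T1
  hd : ∀ a, ∀ t ∈ Icc 0 T0, deriv (χ a) t = g a t
  hχc : Continuous fun p : E3 × ℝ => χ p.1 p.2
  hgc : Continuous fun p : E3 × ℝ => g p.1 p.2
  hχb : ∀ a, ∀ t ∈ Icc 0 T0, |χ a t| ≤ C
  hgb : ∀ a, ∀ t ∈ Icc 0 T0, |g a t| ≤ C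
  hχL : ∀ t ∈ Icc 0 T0, ∀ a b, |χ a t - χ b t| ≤ L * ‖a - b‖
  hgL : ∀ t ∈ Icc 0 T0, ∀ a b, |g a t - g b t| ≤ L * ‖a - b‖
  hχR : ∀ t ∈ Icc 0 T0, ∀ a, R < ‖a‖ → χ a t = 0
  hgR : ∀ t ∈ Icc 0 T0, ∀ a, R < ‖a‖ → g a t = 0

lemma Test.hχT {R L C T1 : ℝ} {χ g : E3 → ℝ → ℝ} (P : Test T0 R L C T1 χ g) (a : E3) (t : ℝ)
    (ht : T1 < t) : χ a t = 0 :=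
  image_eq_zero_of_notMem_tsupport fun h => absurd (P.hts a h) (not_le.2 ht)

lemma Test.hgT {R L C T1 : ℝ} {χ g : E3 → ℝ → ℝ} (P : Test T0 R L C T1 χ g) (a : E3) (t : ℝ)
    (ht : T1 < t) (ht' : t ∈ Icc 0 T0) : g a t = 0 := by
  rw [← P.hd a t ht']
  exact image_eq_zero_of_notMem_tsupport fun h =>
    absurd (P.hts a (tsupport_deriv_subset h)) (not_le.2 ht)

/-- The Lagrangian integrand -/
def integrand (u Y : E3 → ℝ → E3) (ξ : E3 → ℝ → ℝ) (χ g : E3 → ℝ → ℝ) (ρ : E3 → ℝ)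
    (a : E3) (p : E3 × ℝ) : ℝ :=
  ξ p.1 p.2 * (g a p.2 * ρ (p.1 - Y a p.2)
        + χ a p.2 * fderiv ℝ ρ (p.1 - Y a p.2) (u p.1 p.2 - u (Y a p.2) p.2))

lemma integrand_zero (F : NiceFlow T0 M γ Cω u Y Yi) {R L C T1 : ℝ} {χ g : E3 → ℝ → ℝ}
    (P : Test T0 R L C T1 χ g) (ξ : E3 → ℝ → ℝ) (ρ : E3 → ℝ)
    (hρ0 : ∀ z, 1 < ‖z‖ → ρ z = 0) (hdρ0 : ∀ z, 1 < ‖z‖ → fderiv ℝ ρ z = 0)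
    (a : E3) (p : E3 × ℝ) (hp2 : p.2 ∈ Ioo 0 T0)
    (hp : p ∉ Metric.closedBall (0 : E3) (R + M * T0 + 1) ×ˢ Icc 0 T1) :
    integrand u Y ξ χ g ρ a p = 0 := by
  unfold integrand
  have ht : p.2 ∈ Icc 0 T0 := Ioo_subset_Icc_self hp2
  by_cases h1 : T1 < p.2
  · rw [P.hχT a _ h1, P.hgT a _ h1 ht]; simp
  by_cases h2 : R < ‖a‖
  · rw [P.hχR _ ht a h2, P.hgR _ ht a h2]; simp
  have h3 : R + M * T0 + 1 < ‖p.1‖ := by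
    by_contra h3
    exact hp ⟨by simpa using h3, hp2.1.le, not_lt.1 h1⟩
  have h4 : 1 < ‖p.1 - Y a p.2‖ := by
    have := F.norm_Y_le a ht
    have := norm_sub_norm_le p.1 (Y a p.2)
    linarith
  rw [hρ0 _ h4, hdρ0 _ h4]; simp

lemma integrable_ξ {ξ : E3 → ℝ → ℝ}
    (hξloc : LocallyIntegrableOn (fun p : E3 × ℝ => ξ p.1 p.2)
      ((univ : Set E3) ×ˢ Ico 0 T0) volume) (R T1 : ℝ) (hT1 : T1 < T0) :
    Integrable ((Metric.closedBall (0 : E3) R ×ˢ Icc 0 T1).indicator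
      (fun p : E3 × ℝ => ξ p.1 p.2)) volume := by
  have hQc : IsCompact (Metric.closedBall (0 : E3) R ×ˢ Icc 0 T1) :=
    (isCompact_closedBall _ _).prod isCompact_Icc
  refine (integrable_indicator_iff hQc.measurableSet).2 ?_
  refine hξloc.integrableOn_compact_subset ?_ hQc
  rintro ⟨x, t⟩ ⟨_, h2, h3⟩
  exact ⟨trivial, h2, h3.trans_lt hT1⟩

lemma measurable_F (F : NiceFlow T0 M γ Cω u Y Yi) :
    Measurable (fun p : E3 × ℝ => u (Y p.1 p.2) p.2) :=
  F.hum.comp (F.hYc.measurable.prodMk measurable_snd)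

lemma integrable_integrand (F : NiceFlow T0 M γ Cω u Y Yi) {R L C T1 : ℝ} {χ g : E3 → ℝ → ℝ}
    (P : Test T0 R L C T1 χ g) (ξ : E3 → ℝ → ℝ) 
    (hξloc : LocallyIntegrableOn (fun p : E3 × ℝ => ξ p.1 p.2)
      ((univ : Set E3) ×ˢ Ico 0 T0) volume)
    (ρ : E3 → ℝ) (hρ : ContDiff ℝ (⊤ : ℕ∞) ρ) (hρc : HasCompactSupport ρ)
    (hρ0 : ∀ z, 1 < ‖z‖ → ρ z = 0) (hdρ0 : ∀ z, 1 < ‖z‖ → fderiv ℝ ρ z = 0) :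
    Integrable (fun q : E3 × (E3 × ℝ) => integrand u Y ξ χ g ρ q.1 q.2)
      ((volume : Measure E3).prod
        ((volume : Measure (E3 × ℝ)).restrict ((univ : Set E3) ×ˢ Ioo 0 T0))) := by
  set Q := Metric.closedBall (0 : E3) (R + M * T0 + 1) ×ˢ Icc 0 T1 with hQ
  obtain ⟨C3, hC3⟩ := hρc.exists_bound_of_continuous hρ.continuous
  obtain ⟨C4, hC4⟩ := (hρc.fderiv ℝ).exists_bound_of_continuous (hρ.continuous_fderiv (by simp))
  have hC3p : 0 ≤ C3 := (norm_nonneg _).trans (hC3 0)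
  have hC4p : 0 ≤ C4 := (norm_nonneg _).trans (hC4 0)
  have hM := F.hM
  have hCp := P.hC
  have hξi := (integrable_ξ hξloc (R + M * T0 + 1) T1 P.hT1).integrableOn
    (s := (univ : Set E3) ×ˢ Ioo 0 T0)
  have hBi : Integrable ((Metric.closedBall (0 : E3) R).indicator (fun _ => (1:ℝ))) volume :=
    (integrable_indicator_iff measurableSet_closedBall).2
      (integrableOn_const (measure_closedBall_lt_top.ne))
  have hbd := (hBi.mul_prod hξi.norm).mul_const (C * C3 + C * (C4 * (M + M)))
  have hξm : AEStronglyMeasurable (fun p : E3 × ℝ => ξ p.1 p.2)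
      (volume.restrict ((univ : Set E3) ×ˢ Ioo 0 T0)) :=
    hξloc.aestronglyMeasurable.mono_measure
      (Measure.restrict_mono (Set.prod_mono le_rfl Ioo_subset_Ico_self) le_rfl)
  refine hbd.mono' ?_ ?_
  · have h1 : AEStronglyMeasurable (fun q : E3 × (E3 × ℝ) => ξ q.2.1 q.2.2)
      ((volume : Measure E3).prod
        ((volume : Measure (E3 × ℝ)).restrict ((univ : Set E3) ×ˢ Ioo 0 T0))) :=
      hξm.comp_snd
    refine h1.mul (Measurable.aestronglyMeasurable ?_)
    have mat : Measurable (fun q : E3 × (E3 × ℝ) => (q.1, q.2.2)) := by fun_prop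
    have mY : Measurable (fun q : E3 × (E3 × ℝ) => q.2.1 - Y q.1 q.2.2) :=
      (measurable_fst.comp measurable_snd).sub (F.hYc.measurable.comp mat)
    have mU : Measurable (fun q : E3 × (E3 × ℝ) => u q.2.1 q.2.2 - u (Y q.1 q.2.2) q.2.2) :=
      (F.hum.comp measurable_snd).sub (F.measurable_F.comp mat)
    exact ((P.hgc.measurable.comp mat).mul (hρ.continuous.measurable.comp mY)).add
      ((P.hχc.measurable.comp mat).mul
        ((continuous_fderiv_pair ρ hρ).measurable.comp (mY.prodMk mU)))
  · have hae : ∀ᵐ p ∂((volume : Measure (E3 × ℝ)).restrict ((univ : Set E3) ×ˢ Ioo 0 T0)),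
        p.2 ∈ Ioo 0 T0 := by
      filter_upwards [ae_restrict_mem (MeasurableSet.univ.prod measurableSet_Ioo)] with p hp
      exact hp.2
    have hae2 := (Measure.quasiMeasurePreserving_snd (μ := (volume : Measure E3))
      (ν := (volume : Measure (E3 × ℝ)).restrict ((univ : Set E3) ×ˢ Ioo 0 T0))).ae hae
    filter_upwards [hae2] with q hq
    obtain ⟨a, p⟩ := q
    simp only at hq ⊢
    have ht : p.2 ∈ Icc 0 T0 := Ioo_subset_Icc_self hq
    by_cases hp : p ∈ Q
    · by_cases ha : ‖a‖ ≤ R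
      · rw [indicator_of_mem (by simpa using ha), indicator_of_mem hp, one_mul]
        unfold integrand
        rw [norm_mul]
        refine mul_le_mul_of_nonneg_left ?_ (norm_nonneg _)
        refine (norm_add_le _ _).trans ?_
        rw [norm_mul, norm_mul]
        gcongr
        · exact P.hgb _ _ ht
        · exact hC3 _
        · exact P.hχb _ _ ht
        · refine (ContinuousLinearMap.le_opNorm _ _).trans ?_
          gcongr
          · exact hC4 _
          · exact (norm_sub_le _ _).trans (add_le_add (F.hub _ _) (F.hub _ _))
      · have ha' := not_le.1 ha
        unfold integrand
        rw [P.hχR _ ht a ha', P.hgR _ ht a ha']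
        simp only [zero_mul, add_zero, mul_zero, norm_zero]
        refine mul_nonneg (mul_nonneg ?_ (norm_nonneg _)) (by positivity)
        exact indicator_nonneg (fun _ _ => zero_le_one) _
    · rw [F.integrand_zero P ξ ρ hρ0 hdρ0 a p hq hp, indicator_of_notMem hp]
      simp

end NiceFlow


namespace NiceFlow
variable {T0 M γ Cω : ℝ} {u Y Yi : E3 → ℝ → E3}

lemma integral_change (F : NiceFlow T0 M γ Cω u Y Yi) (t : ℝ) (G : E3 → ℝ) :
    ∫ a, G (Y a t) = ∫ y, G y := by
  have hemb : MeasurableEmbedding (fun a => Y a t) := by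
    have c1 : Continuous (fun a => Y a t) := F.hYc.comp (continuous_id.prodMk continuous_const)
    have c2 : Continuous (fun a => Yi a t) := F.hYic.comp (continuous_id.prodMk continuous_const)
    exact (Homeomorph.measurableEmbedding
      ⟨⟨fun a => Y a t, fun a => Yi a t, fun a => F.hl a t, fun a => F.hr a t⟩, c1, c2⟩)
  exact (F.hmp t).integral_comp hemb G

lemma core_bound (F : NiceFlow T0 M γ Cω u Y Yi) (hT0 : 0 < T0) {R L C T1 : ℝ}
    {χ g : E3 → ℝ → ℝ}
    (P : Test T0 R L C T1 χ g) (ξ₀ : E3 → ℝ) (hξ₀ : Integrable ξ₀ volume) (ξ : E3 → ℝ → ℝ)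
    (hξloc : LocallyIntegrableOn (fun p : E3 × ℝ => ξ p.1 p.2)
      ((univ : Set E3) ×ˢ Ico 0 T0) volume)
    (htransport : ∀ ψ : E3 × ℝ → ℝ, ContDiff ℝ (⊤ : ℕ∞) ψ → HasCompactSupport ψ →
      tsupport ψ ⊆ (univ : Set E3) ×ˢ Iio T0 →
      (∫ p : E3 × ℝ in (univ : Set E3) ×ˢ Ioo 0 T0,
          ξ p.1 p.2 *
            (deriv (fun s => ψ (p.1, s)) p.2 +
              fderiv ℝ (fun y => ψ (y, p.2)) p.1 (u p.1 p.2)))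
        + (∫ x : E3, ξ₀ x * ψ (x, 0)) = 0)
    {CH : ℝ} (hCH0 : 0 ≤ CH)
    (hCH : ∀ t, ∀ x ∈ Metric.closedBall (0 : E3) (R + M * T0 + 1),
      ∀ y ∈ Metric.closedBall (0 : E3) (R + M * T0 + 1),
      ‖Yi x t - Yi y t‖ ≤ CH * ‖x - y‖ ^ γ)
    {ε b : ℝ} (hε0 : 0 < ε) (hε : ε ≤ 1)
    (ρ : E3 → ℝ) (hρs : ContDiff ℝ (⊤ : ℕ∞) ρ)
    (hρc : HasCompactSupport ρ) (hρn : ∀ z, 0 ≤ ρ z) (hρi : ∫ z, ρ z = 1)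
    (hρ0 : ∀ z, ε < ‖z‖ → ρ z = 0) 
    (hdρ0 : ∀ z, ε < ‖z‖ → fderiv ℝ ρ z = 0) (hb : ∫ z, ‖fderiv ℝ ρ z‖ ≤ b) :
    |(∫ p : E3 × ℝ in (univ : Set E3) ×ˢ Ioo 0 T0, ξ p.1 p.2 * g (Yi p.1 p.2) p.2)
      + ∫ x, ξ₀ x * χ x 0| ≤
    (L * CH * ε ^ γ + L * CH * ε ^ γ * (Cω * ε ^ (1 - γ / 2)) * b) *
      (∫ p, ‖(Metric.closedBall (0 : E3) (R + M * T0 + 1) ×ˢ Icc 0 T1).indicator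
      (fun p : E3 × ℝ => ξ p.1 p.2) p‖) + L * CH * ε ^ γ * ∫ x, ‖ξ₀ x‖ := by
  set μ := ((volume : Measure (E3 × ℝ)).restrict ((univ : Set E3) ×ˢ Ioo 0 T0)) with hμ
  set Q := Metric.closedBall (0 : E3) (R + M * T0 + 1) ×ˢ Icc 0 T1 with hQ
  set δ := L * CH * ε ^ γ with hδ
  set ω := Cω * ε ^ (1 - γ / 2) with hω
  have hL := P.hL
  have hδ0 : 0 ≤ δ := by positivity
  have hω0 : 0 ≤ ω := mul_nonneg F.hCω (by positivity)
  have hρ1 : ∀ z, 1 < ‖z‖ → ρ z = 0 := fun z hz => hρ0 z (hε.trans_lt hz)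
  have hdρ1 : ∀ z, 1 < ‖z‖ → fderiv ℝ ρ z = 0 := fun z hz => hdρ0 z (hε.trans_lt hz)
  have h0T : (0:ℝ) ∈ Icc 0 T0 := ⟨le_rfl, hT0.le⟩
  have hHi := F.integrable_integrand P ξ hξloc ρ hρs hρc hρ1 hdρ1
  have hξi := (integrable_ξ hξloc (R + M * T0 + 1) T1 P.hT1)
  have hmem : ∀ᵐ p ∂μ, p.2 ∈ Ioo 0 T0 := by
    filter_upwards [ae_restrict_mem (MeasurableSet.univ.prod measurableSet_Ioo)] with p hp
    exact hp.2
  -- step 1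
  have step1 : ∀ a, (∫ p, integrand u Y ξ χ g ρ a p ∂μ)
      + ∫ x : E3, ξ₀ x * (χ a 0 * ρ (x - a)) = 0 := by
    intro a
    have mat : Measurable (fun s : ℝ => (a, s)) := by fun_prop
    have := path_identity T0 u F.hum F.hub ξ₀ ξ hξloc htransport (fun s => u (Y a s) s)
      (F.measurable_F.comp mat) (fun t => F.hub _ _) (Y a) a (F.hode a) (χ a) (P.hs a) (P.hcs a)
      (fun t ht => (P.hts a ht).trans_lt P.hT1) ρ hρs hρc
    refine Eq.trans ?_ this
    congr 1
    apply integral_congr_ae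
    filter_upwards [hmem] with p hp
    simp only [integrand]
    rw [P.hd a _ (Ioo_subset_Icc_self hp)]
  -- step 2
  have hH1 : Integrable (fun a => ∫ p, integrand u Y ξ χ g ρ a p ∂μ) volume :=
    hHi.integral_prod_left
  have step2 : (∫ a, ∫ p, integrand u Y ξ χ g ρ a p ∂μ)
      = ∫ p, (∫ a, integrand u Y ξ χ g ρ a p) ∂μ := integral_integral_swap hHi
  -- initial term
  have hχ0c : Continuous fun a => χ a 0 := P.hχc.comp (continuous_id.prodMk continuous_const)
  have hχ0s : HasCompactSupport fun a => χ a 0 := by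
    apply HasCompactSupport.intro (isCompact_closedBall (0 : E3) R)
    intro a ha
    exact P.hχR 0 h0T a (by simpa using ha)
  obtain ⟨C3, hC3⟩ := hρc.exists_bound_of_continuous hρs.continuous
  have hKi : Integrable (fun q : E3 × E3 => ξ₀ q.2 * (χ q.1 0 * ρ (q.2 - q.1)))
      ((volume : Measure E3).prod (volume : Measure E3)) := by
    have h1 := (hχ0c.integrable_of_hasCompactSupport hχ0s (μ := volume)).mul_prod hξ₀
    have h2 : AEStronglyMeasurable (fun q : E3 × E3 => ρ (q.2 - q.1))
      ((volume : Measure E3).prod (volume : Measure E3)) :=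
      (hρs.continuous.comp (continuous_snd.sub continuous_fst)).aestronglyMeasurable
    have h3 := h1.mul_bdd (c := C3) h2 (ae_of_all _ fun q => hC3 _)
    refine h3.congr (ae_of_all _ fun q => ?_)
    simp only
    ring
  have step3 : (∫ a, ∫ x, ξ₀ x * (χ a 0 * ρ (x - a)))
      = ∫ x, ∫ a, ξ₀ x * (χ a 0 * ρ (x - a)) := integral_integral_swap hKi
  have step4 : (∫ p, (∫ a, integrand u Y ξ χ g ρ a p) ∂μ)
      + (∫ x, ∫ a, ξ₀ x * (χ a 0 * ρ (x - a))) = 0 := by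
    rw [← step2, ← step3, ← integral_add hH1 hKi.integral_prod_left]
    simp only [step1, integral_zero]
  -- continuity of slices
  have cYi : ∀ t, Continuous fun y => Yi y t := fun t =>
    F.hYic.comp (continuous_id.prodMk continuous_const)
  have cg : ∀ t, Continuous fun y => g (Yi y t) t := fun t =>
    P.hgc.comp ((cYi t).prodMk continuous_const)
  have cχ : ∀ t, Continuous fun y => χ (Yi y t) t := fun t =>
    P.hχc.comp ((cYi t).prodMk continuous_const)
  -- estimate of the bulk term
  have hdiv' : ∀ᵐ p ∂μ, ∀ x, ∫ y, fderiv ℝ ρ (x - y) (u x p.2 - u y p.2) = 0 := by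
    have h1 : μ = (volume : Measure E3).prod (volume.restrict (Ioo 0 T0)) := by
      rw [hμ, Measure.volume_eq_prod, ← Measure.prod_restrict, Measure.restrict_univ]
    rw [h1]
    exact Measure.quasiMeasurePreserving_snd.ae (F.hdiv ρ hρs hρc)
  have hbulk : ∀ᵐ p ∂μ, ‖ξ p.1 p.2 * g (Yi p.1 p.2) p.2 - ∫ a, integrand u Y ξ χ g ρ a p‖
      ≤ (δ + δ * ω * b) * ‖Q.indicator (fun p : E3 × ℝ => ξ p.1 p.2) p‖ := by
    filter_upwards [hmem, hdiv'] with p hp hdp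
    have ht : p.2 ∈ Icc 0 T0 := Ioo_subset_Icc_self hp
    by_cases hpQ : p ∈ Q
    · rw [indicator_of_mem hpQ]
      obtain ⟨x, t⟩ := p
      simp only at ht hdp ⊢
      have e1 : ∫ a, integrand u Y ξ χ g ρ a (x, t)
          = ξ x t * ((∫ y, g (Yi y t) t * ρ (x - y))
            + ∫ y, χ (Yi y t) t * fderiv ℝ ρ (x - y) (u x t - u y t)) := by
        have i1 : Integrable (fun y => g (Yi y t) t * ρ (x - y)) volume := by
          apply Continuous.integrable_of_hasCompactSupport
          · exact (cg t).mul (hρs.continuous.comp (continuous_const.sub continuous_id))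
          · exact (hρc.comp_homeomorph (Homeomorph.subLeft x)).mul_left
        have i2 := integrable_Dρ ρ hρs hρc (fun y => χ (Yi y t) t) (cχ t) x
          (fun y => u x t - u y t) (continuous_const.sub (F.huc t))
        calc ∫ a, integrand u Y ξ χ g ρ a (x, t)
            = ∫ a, (fun y => ξ x t * (g (Yi y t) t * ρ (x - y)
              + χ (Yi y t) t * fderiv ℝ ρ (x - y) (u x t - u y t))) (Y a t) := by
              simp only [integrand, F.hl]
          _ = ∫ y, ξ x t * (g (Yi y t) t * ρ (x - y)
              + χ (Yi y t) t * fderiv ℝ ρ (x - y) (u x t - u y t)) :=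
              F.integral_change t (fun y => ξ x t * (g (Yi y t) t * ρ (x - y)
              + χ (Yi y t) t * fderiv ℝ ρ (x - y) (u x t - u y t)))
          _ = _ := by rw [integral_const_mul, integral_add i1 i2]
      have b1 := mollify_est1 ρ hρs hρc hρn hρi hρ0 (fun y => g (Yi y t) t) (cg t) x
        (fun y hy => F.modulus hCH0 hL hCH hε ht (fun a => g a t) (P.hgL t ht) (P.hgR t ht) x y hy)
      have b2 := mollify_est2 hω0 hδ0 ρ hρs hρc hdρ0 hb (fun y => χ (Yi y t) t) (cχ t) x
        (fun y hy => F.modulus hCH0 hL hCH hε ht (fun a => χ a t) (P.hχL t ht) (P.hχR t ht) x y hy)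
        (fun y => u y t) (F.huc t) (fun y hy => by
          refine (F.hω t x y (hy.trans hε)).trans ?_
          refine mul_le_mul_of_nonneg_left ?_ F.hCω
          exact Real.rpow_le_rpow (norm_nonneg _) hy (by linarith [F.hγ1])) (hdp x)
      rw [e1, ← mul_sub, norm_mul, mul_comm]
      refine mul_le_mul_of_nonneg_right ?_ (norm_nonneg _)
      rw [← sub_sub, Real.norm_eq_abs]
      refine (abs_sub _ _).trans ?_
      rw [abs_sub_comm] at b1
      exact add_le_add b1 b2
    · rw [indicator_of_notMem hpQ]
      have e1 : ∀ a, integrand u Y ξ χ g ρ a p = 0 := fun a =>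
        F.integrand_zero P ξ ρ hρ1 hdρ1 a p hp hpQ
      have e2 : g (Yi p.1 p.2) p.2 = 0 := by
        by_cases h1 : T1 < p.2
        · exact P.hgT _ _ h1 ht
        apply P.hgR _ ht
        by_contra h2
        apply hpQ
        have := F.norm_Y_le (Yi p.1 p.2) ht
        rw [F.hr] at this
        refine ⟨?_, hp.1.le, not_lt.1 h1⟩
        rw [mem_closedBall_zero_iff]
        linarith
      simp [e1, e2]
  have hH2 : Integrable (fun p => ∫ a, integrand u Y ξ χ g ρ a p) μ := hHi.integral_prod_right
  have hbdi : Integrable (fun p => (δ + δ * ω * b) *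
      ‖Q.indicator (fun p : E3 × ℝ => ξ p.1 p.2) p‖) μ :=
    (hξi.norm.const_mul _).integrableOn
  have hξm : AEStronglyMeasurable (fun p : E3 × ℝ => ξ p.1 p.2) μ :=
    hξloc.aestronglyMeasurable.mono_measure
      (Measure.restrict_mono (Set.prod_mono le_rfl Ioo_subset_Ico_self) le_rfl)
  have hgm : AEStronglyMeasurable (fun p : E3 × ℝ => ξ p.1 p.2 * g (Yi p.1 p.2) p.2) μ :=
    hξm.mul (P.hgc.comp (F.hYic.prodMk continuous_snd)).aestronglyMeasurable
  have hdi : Integrable (fun p => ξ p.1 p.2 * g (Yi p.1 p.2) p.2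
      - ∫ a, integrand u Y ξ χ g ρ a p) μ :=
    hbdi.mono' (hgm.sub hH2.aestronglyMeasurable) hbulk
  have hgi : Integrable (fun p : E3 × ℝ => ξ p.1 p.2 * g (Yi p.1 p.2) p.2) μ := by
    refine (hdi.add hH2).congr (ae_of_all _ fun p => ?_)
    simp
  have est1 : |(∫ p, ξ p.1 p.2 * g (Yi p.1 p.2) p.2 ∂μ)
      - ∫ p, (∫ a, integrand u Y ξ χ g ρ a p) ∂μ| ≤
      (δ + δ * ω * b) * (∫ p, ‖Q.indicator (fun p : E3 × ℝ => ξ p.1 p.2) p‖) := by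
    rw [← integral_sub hgi hH2, ← Real.norm_eq_abs]
    refine (norm_integral_le_of_norm_le hbdi hbulk).trans ?_
    rw [integral_const_mul]
    have hb0 : 0 ≤ b := (integral_nonneg fun _ => norm_nonneg _).trans hb
    refine mul_le_mul_of_nonneg_left ?_ (by positivity)
    exact integral_mono_measure Measure.restrict_le_self (ae_of_all _ fun _ => norm_nonneg _)
      hξi.norm
  have hinit : ∀ x, ‖ξ₀ x * χ x 0 - ∫ a, ξ₀ x * (χ a 0 * ρ (x - a))‖ ≤ δ * ‖ξ₀ x‖ := by
    intro x
    have b1 := mollify_est1 ρ hρs hρc hρn hρi hρ0 (fun y => χ y 0) hχ0c x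
        (fun y hy => by
          have := F.modulus hCH0 hL hCH hε h0T (fun a => χ a 0) (P.hχL 0 h0T) (P.hχR 0 h0T) x y hy
          simpa only [F.Yi0] using this)
    rw [integral_const_mul, ← mul_sub, norm_mul, mul_comm]
    refine mul_le_mul_of_nonneg_right ?_ (norm_nonneg _)
    rw [abs_sub_comm] at b1
    exact b1
  have hK2 : Integrable (fun x => ∫ a, ξ₀ x * (χ a 0 * ρ (x - a))) volume :=
    hKi.integral_prod_right
  have hχi : Integrable (fun x => ξ₀ x * χ x 0) volume := by
    obtain ⟨C5, hC5⟩ := hχ0s.exists_bound_of_continuous hχ0c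
    exact hξ₀.mul_bdd (c := C5) hχ0c.aestronglyMeasurable (ae_of_all _ hC5)
  have est2 : |(∫ x, ξ₀ x * χ x 0) - ∫ x, ∫ a, ξ₀ x * (χ a 0 * ρ (x - a))| ≤
      δ * ∫ x, ‖ξ₀ x‖ := by
    rw [← integral_sub hχi hK2, ← Real.norm_eq_abs, ← integral_const_mul]
    exact norm_integral_le_of_norm_le (hξ₀.norm.const_mul _) (ae_of_all _ hinit)
  have : ∀ A B A' B' : ℝ, A' + B' = 0 → A + B = (A - A') + (B - B') := by
    intros; linarith
  rw [this _ _ _ _ step4]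
  exact (abs_add_le _ _).trans (add_le_add est1 est2)

lemma core (F : NiceFlow T0 M γ Cω u Y Yi) (hT0 : 0 < T0) {R L C T1 : ℝ}
    {χ g : E3 → ℝ → ℝ}
    (P : Test T0 R L C T1 χ g) (ξ₀ : E3 → ℝ) (hξ₀ : Integrable ξ₀ volume) (ξ : E3 → ℝ → ℝ)
    (hξloc : LocallyIntegrableOn (fun p : E3 × ℝ => ξ p.1 p.2)
      ((univ : Set E3) ×ˢ Ico 0 T0) volume)
    (htransport : ∀ ψ : E3 × ℝ → ℝ, ContDiff ℝ (⊤ : ℕ∞) ψ → HasCompactSupport ψ →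
      tsupport ψ ⊆ (univ : Set E3) ×ˢ Iio T0 →
      (∫ p : E3 × ℝ in (univ : Set E3) ×ˢ Ioo 0 T0,
          ξ p.1 p.2 *
            (deriv (fun s => ψ (p.1, s)) p.2 +
              fderiv ℝ (fun y => ψ (y, p.2)) p.1 (u p.1 p.2)))
        + (∫ x : E3, ξ₀ x * ψ (x, 0)) = 0) :
    (∫ p : E3 × ℝ in (univ : Set E3) ×ˢ Ioo 0 T0, ξ p.1 p.2 * g (Yi p.1 p.2) p.2)
      + ∫ x, ξ₀ x * χ x 0 = 0 := by
  obtain ⟨B, hB0, hB⟩ := exists_mollifier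
  obtain ⟨CH, hCH0, hCH⟩ := F.hH _ (isCompact_closedBall (0 : E3) (R + M * T0 + 1))
  set A := (∫ p : E3 × ℝ in (univ : Set E3) ×ˢ Ioo 0 T0, ξ p.1 p.2 * g (Yi p.1 p.2) p.2)
      + ∫ x, ξ₀ x * χ x 0 with hA
  set I1 := (∫ p, ‖(Metric.closedBall (0 : E3) (R + M * T0 + 1) ×ˢ Icc 0 T1).indicator
      (fun p : E3 × ℝ => ξ p.1 p.2) p‖) with hI1
  set I2 := ∫ x, ‖ξ₀ x‖ with hI2
  have hL := P.hL
  have hγ := F.hγ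
  have hCω := F.hCω
  have bound : ∀ ε ∈ Ioc (0:ℝ) 1, |A| ≤ (L * CH * ε ^ γ
      + L * CH * Cω * B * ε ^ (γ / 2)) * I1 + L * CH * ε ^ γ * I2 := by
    rintro ε ⟨hε0, hε1⟩
    obtain ⟨ρ, h1, h2, h3, h4, h5, h6, h7⟩ := hB ε hε0
    have := F.core_bound hT0 P ξ₀ hξ₀ ξ hξloc htransport hCH0 hCH hε0 hε1 ρ h1 h2 h3 h4 h5 h6 h7
    convert this using 4
    have e : ε ^ (γ / 2) = ε ^ γ * ε ^ (1 - γ / 2) / ε := by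
      rw [← Real.rpow_add hε0, ← Real.rpow_sub_one hε0.ne']
      congr 1; ring
    rw [e]; ring
  have hlim : Tendsto (fun ε : ℝ => (L * CH * ε ^ γ
      + L * CH * Cω * B * ε ^ (γ / 2)) * I1 + L * CH * ε ^ γ * I2) (nhdsWithin 0 (Ioi 0))
      (nhds 0) := by
    have hc : Continuous (fun ε : ℝ => (L * CH * ε ^ γ
      + L * CH * Cω * B * ε ^ (γ / 2)) * I1 + L * CH * ε ^ γ * I2) := by
      have c1 := Real.continuous_rpow_const hγ.le
      have c2 := Real.continuous_rpow_const (q := γ / 2) (by positivity)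
      fun_prop
    have h0 := (hc.tendsto 0).mono_left (nhdsWithin_le_nhds (s := Ioi 0))
    have hγ2 : γ / 2 ≠ 0 := by positivity
    simpa [Real.zero_rpow hγ.ne', Real.zero_rpow hγ2] using h0
  have : |A| ≤ 0 := by
    refine ge_of_tendsto hlim ?_
    filter_upwards [Ioc_mem_nhdsGT (zero_lt_one (α := ℝ))] with ε hε using bound ε hε
  exact abs_eq_zero.1 (le_antisymm this (abs_nonneg _))

end NiceFlow


lemma exists_test {T0 : ℝ} (hT0 : 0 < T0) (G : E3 × ℝ → ℝ) (hG : ContDiff ℝ (⊤ : ℕ∞) G)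
    (hGc : HasCompactSupport G) (hGt : tsupport G ⊆ (univ : Set E3) ×ˢ Ioo 0 T0) :
    ∃ (R L C T1 : ℝ) (χ : E3 → ℝ → ℝ), NiceFlow.Test T0 R L C T1 χ (fun a t => G (a, t)) ∧
      ∀ a, χ a 0 = - ∫ s in (0:ℝ)..T0, G (a, s) := by
  obtain ⟨K, hK⟩ := ContDiff.lipschitzWith_of_hasCompactSupport hGc hG (by simp)
  obtain ⟨B, hB⟩ := hGc.exists_bound_of_continuous hG.continuous
  have hB0 : 0 ≤ B := (norm_nonneg _).trans (hB 0)
  obtain ⟨R, hR⟩ := (IsCompact.isBounded hGc).subset_closedBall (0 : E3 × ℝ)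
  have hGR : ∀ a t, R < ‖a‖ → G (a, t) = 0 := by
    intro a t h
    refine image_eq_zero_of_notMem_tsupport fun h' => ?_
    have h2 := hR h'
    rw [mem_closedBall_zero_iff, Prod.norm_def] at h2
    exact absurd ((le_max_left _ _).trans h2) (not_le.2 h)
  obtain ⟨T1, hT1, hGT⟩ : ∃ T1 < T0, ∀ a t, T1 < t → G (a, t) = 0 := by
    have hc : IsCompact (Prod.snd '' tsupport G) := IsCompact.image hGc continuous_snd
    rcases (tsupport G).eq_empty_or_nonempty with he | hne
    · refine ⟨0, hT0, fun a t _ => image_eq_zero_of_notMem_tsupport (by rw [he]; simp)⟩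
    · obtain ⟨T1, h1, h2⟩ := hc.exists_isGreatest (hne.image _)
      refine ⟨T1, ?_, fun a t ht => image_eq_zero_of_notMem_tsupport fun h => ?_⟩
      · obtain ⟨p, hp, rfl⟩ := h1
        exact (hGt hp).2.2
      · exact absurd (h2 ⟨_, h, rfl⟩) (not_le.2 ht)
  let c : ContDiffBump (0 : ℝ) := ⟨T0 + 1, T0 + 2, by linarith, by linarith⟩
  have hc1 : ∀ t, |t| ≤ T0 + 1 → c t = 1 := fun t ht =>
    c.one_of_mem_closedBall (by simpa [Real.norm_eq_abs] using ht)
  have hcI : ∀ t ∈ Icc 0 T0, c t = 1 := fun t ht => hc1 t (by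
    rw [abs_of_nonneg ht.1]; linarith [ht.2])
  have hGa : ∀ a, ContDiff ℝ (⊤ : ℕ∞) (fun t : ℝ => G (a, t)) := fun a =>
    hG.comp (contDiff_const.prodMk contDiff_id)
  have hGac : ∀ a, Continuous (fun t : ℝ => G (a, t)) := fun a => (hGa a).continuous
  have hint0 : ∀ a t, T1 < t → ∫ s in T0..t, G (a, s) = 0 := by
    intro a t ht
    refine intervalIntegral.integral_zero_ae (Eventually.of_forall fun s hs => hGT a s ?_)
    have := hs.1
    exact (lt_min hT1 ht).trans this
  have hB' : ∀ a, ∀ t ∈ Icc 0 T0, |∫ s in T0..t, G (a, s)| ≤ B * T0 := by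
    intro a t ht
    have := intervalIntegral.norm_integral_le_of_norm_le_const (a := T0) (b := t)
      (f := fun s => G (a, s)) (C := B) (fun s _ => hB _)
    refine this.trans (mul_le_mul_of_nonneg_left ?_ hB0)
    rw [abs_le]; constructor <;> linarith [ht.1, ht.2]
  have hKab : ∀ a b t, |G (a, t) - G (b, t)| ≤ K * ‖a - b‖ := by
    intro a b t
    have := hK.norm_sub_le (a, t) (b, t)
    simpa [Prod.norm_def, Real.norm_eq_abs] using this
  have hK' : ∀ t ∈ Icc 0 T0, ∀ a b,
      |(∫ s in T0..t, G (a, s)) - ∫ s in T0..t, G (b, s)| ≤ K * T0 * ‖a - b‖ := by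
    intro t ht a b
    rw [← intervalIntegral.integral_sub ((hGac a).intervalIntegrable _ _)
      ((hGac b).intervalIntegrable _ _)]
    have := intervalIntegral.norm_integral_le_of_norm_le_const (a := T0) (b := t)
      (f := fun s => G (a, s) - G (b, s)) (C := K * ‖a - b‖) (fun s _ => hKab a b s)
    refine this.trans ?_
    rw [mul_right_comm]
    have h3 : |t - T0| ≤ T0 := by rw [abs_le]; constructor <;> linarith [ht.1, ht.2]
    gcongr
  refine ⟨R, K * (1 + T0), B * (1 + T0), T1, fun a t => c t * ∫ s in T0..t, G (a, s), ?_, ?_⟩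
  · constructor
    · exact hT1
    · positivity
    · positivity
    · intro a
      exact c.contDiff.mul (contDiff_primitive_real _ _ (hGa a)).1
    · intro a
      exact c.hasCompactSupport.mul_right
    · intro a
      refine closure_minimal (fun t ht => ?_) isClosed_Iic
      by_contra h
      exact ht (by simp only [hint0 a t (not_le.1 h), mul_zero])
    · intro a t ht
      have h1 : (fun t => c t * ∫ s in T0..t, G (a, s)) =ᶠ[nhds t] fun t => ∫ s in T0..t, G (a, s) := by
        have : Ioo (-1 : ℝ) (T0 + 1) ∈ nhds t := Ioo_mem_nhds (by linarith [ht.1]) (by linarith [ht.2])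
        filter_upwards [this] with s hs
        rw [hc1 s (by rw [abs_le]; constructor <;> linarith [hs.1, hs.2]), one_mul]
      rw [h1.deriv_eq]
      exact ((contDiff_primitive_real _ _ (hGa a)).2 t).deriv
    · refine (c.continuous.comp continuous_snd).mul ?_
      exact intervalIntegral.continuous_parametric_intervalIntegral_of_continuous
        (f := fun (p : E3 × ℝ) s => G (p.1, s)) (by fun_prop) continuous_snd
    · exact hG.continuous
    · intro a t ht
      rw [hcI t ht, one_mul]
      exact (hB' a t ht).trans (by nlinarith)
    · intro a t ht
      exact (hB _).trans (by nlinarith)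
    · intro t ht a b
      rw [hcI t ht, one_mul, one_mul]
      refine (hK' t ht a b).trans ?_
      gcongr
      linarith
    · intro t ht a b
      refine (hKab a b t).trans ?_
      gcongr
      have : (0:ℝ) ≤ K := K.2
      nlinarith
    · intro t ht a ha
      simp [hGR a _ ha]
    · intro t ht a ha
      exact hGR a t ha
  · intro a
    simp only
    rw [hcI 0 ⟨le_rfl, hT0.le⟩, one_mul, intervalIntegral.integral_symm]

namespace NiceFlow
variable {T0 M γ Cω : ℝ} {u Y Yi : E3 → ℝ → E3}

/-- space-time flow homeomorphism -/
def Θ (F : NiceFlow T0 M γ Cω u Y Yi) : (E3 × ℝ) ≃ₜ (E3 × ℝ) where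
  toFun p := (Y p.1 p.2, p.2)
  invFun p := (Yi p.1 p.2, p.2)
  left_inv p := by simp [F.hl]
  right_inv p := by simp [F.hr]
  continuous_toFun := F.hYc.prodMk continuous_snd
  continuous_invFun := F.hYic.prodMk continuous_snd

lemma mpΘ (F : NiceFlow T0 M γ Cω u Y Yi) : MeasurePreserving F.Θ volume volume := by
  have h1 : MeasurePreserving (fun p : ℝ × E3 => (p.1, Y p.2 p.1))
      ((volume : Measure ℝ).prod (volume : Measure E3)) (volume.prod volume) := by
    refine MeasurePreserving.skew_product (f := id) (g := fun t a => Y a t)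
      (MeasurePreserving.id _) ?_ (Eventually.of_forall fun t => (F.hmp t).map_eq)
    exact (F.hYc.comp continuous_swap).measurable
  have h2 := (Measure.measurePreserving_swap (μ := (volume : Measure ℝ)) (ν := (volume : Measure E3)))
  have h3 := (Measure.measurePreserving_swap (μ := (volume : Measure E3)) (ν := (volume : Measure ℝ)))
  exact h2.comp (h1.comp h3)

lemma final (F : NiceFlow T0 M γ Cω u Y Yi) (hT0 : 0 < T0)
    (ξ₀ : E3 → ℝ) (hξ₀ : Integrable ξ₀ volume) (ξ : E3 → ℝ → ℝ)
    (hξloc : LocallyIntegrableOn (fun p : E3 × ℝ => ξ p.1 p.2)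
      ((univ : Set E3) ×ˢ Ico 0 T0) volume)
    (htransport : ∀ ψ : E3 × ℝ → ℝ, ContDiff ℝ (⊤ : ℕ∞) ψ → HasCompactSupport ψ →
      tsupport ψ ⊆ (univ : Set E3) ×ˢ Iio T0 →
      (∫ p : E3 × ℝ in (univ : Set E3) ×ˢ Ioo 0 T0,
          ξ p.1 p.2 *
            (deriv (fun s => ψ (p.1, s)) p.2 +
              fderiv ℝ (fun y => ψ (y, p.2)) p.1 (u p.1 p.2)))
        + (∫ x : E3, ξ₀ x * ψ (x, 0)) = 0) :
    ∀ᵐ p : E3 × ℝ ∂(volume.restrict ((univ : Set E3) ×ˢ Ioo 0 T0)),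
      ξ p.1 p.2 = ξ₀ (Yi p.1 p.2) := by
  set U : Set (E3 × ℝ) := (univ : Set E3) ×ˢ Ioo 0 T0 with hU
  have hUo : IsOpen U := isOpen_univ.prod isOpen_Ioo
  have hUm : MeasurableSet U := hUo.measurableSet
  have hpre : F.Θ ⁻¹' U = U := by
    ext p; simp [U, Θ]
  have hme := F.Θ.measurableEmbedding
  have hmp := F.mpΘ
  have hmpU : MeasurePreserving F.Θ (volume.restrict U) (volume.restrict U) := by
    have := hmp.restrict_preimage hUm
    rwa [hpre] at this
  have hμ : (volume.restrict U : Measure (E3 × ℝ))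
      = (volume : Measure E3).prod (volume.restrict (Ioo 0 T0)) := by
    rw [hU, Measure.volume_eq_prod, ← Measure.prod_restrict, Measure.restrict_univ]
  have hξ0loc : Integrable (fun p : E3 × ℝ => ξ₀ p.1) (volume.restrict U) := by
    rw [hμ]
    exact hξ₀.comp_fst _
  have hf1 : LocallyIntegrableOn (fun p : E3 × ℝ => ξ (Y p.1 p.2) p.2) U volume := by
    rw [locallyIntegrableOn_iff hUo.isLocallyClosed]
    intro k hk hkc
    have h1 : IsCompact (F.Θ '' k) := hkc.image F.Θ.continuous
    have h2 : F.Θ '' k ⊆ (univ : Set E3) ×ˢ Ico 0 T0 := by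
      rintro _ ⟨p, hp, rfl⟩
      exact ⟨mem_univ _, Ioo_subset_Ico_self (hk hp).2⟩
    have h3 := (hξloc.mono_set h2).integrableOn_isCompact h1
    exact (hmp.integrableOn_image hme).1 h3
  have hf2 : LocallyIntegrableOn (fun p : E3 × ℝ => ξ₀ p.1) U volume := 
    IntegrableOn.locallyIntegrableOn hξ0loc
  have key := hUo.ae_eq_zero_of_integral_contDiff_smul_eq_zero (μ := volume)
    (f := fun p : E3 × ℝ => ξ (Y p.1 p.2) p.2 - ξ₀ p.1) (hf1.sub hf2) (by
    intro G hG hGc hGt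
    obtain ⟨R, L, C, T1, χ, P, hχ⟩ := exists_test hT0 G hG hGc hGt
    have hc := F.core hT0 P ξ₀ hξ₀ ξ hξloc htransport
    have hG0 : ∀ p, p ∉ U → G p = 0 := fun p hp =>
      image_eq_zero_of_notMem_tsupport fun h => hp (hGt h)
    have i1 : Integrable (fun p : E3 × ℝ => G p • ξ (Y p.1 p.2) p.2) volume := by
      have h1 := (hf1.mono_set hGt).integrableOn_isCompact hGc
      have h2 := h1.continuousOn_smul hG.continuous.continuousOn hGc
      rwa [integrableOn_iff_integrable_of_support_subset] at h2
      refine fun p hp => subset_tsupport _ ?_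
      intro h; exact hp (by simp [h])
    have i2 : Integrable (fun p : E3 × ℝ => G p • ξ₀ p.1) volume := by
      have h1 := (hf2.mono_set hGt).integrableOn_isCompact hGc
      have h2 := h1.continuousOn_smul hG.continuous.continuousOn hGc
      rwa [integrableOn_iff_integrable_of_support_subset] at h2
      refine fun p hp => subset_tsupport _ ?_
      intro h; exact hp (by simp [h])
    have e1 : ∫ p, G p • ξ (Y p.1 p.2) p.2 = ∫ p in U, ξ p.1 p.2 * G (Yi p.1 p.2, p.2) := by
      rw [← setIntegral_eq_integral_of_forall_compl_eq_zero (s := U)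
        (fun p hp => by rw [hG0 p hp, zero_smul])]
      rw [← hmpU.integral_comp hme (fun p => ξ p.1 p.2 * G (Yi p.1 p.2, p.2))]
      refine integral_congr_ae (Eventually.of_forall fun p => ?_)
      simp [Θ, F.hl, mul_comm]
    have e2 : ∫ p, G p • ξ₀ p.1 = ∫ a, ξ₀ a * ∫ s in (0:ℝ)..T0, G (a, s) := by
      rw [← setIntegral_eq_integral_of_forall_compl_eq_zero (s := U)
        (fun p hp => by rw [hG0 p hp, zero_smul])]
      rw [hμ, integral_prod _ (by rw [← hμ]; exact i2.restrict)]
      refine integral_congr_ae (Eventually.of_forall fun a => ?_)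
      simp only [smul_eq_mul]
      rw [integral_mul_const, mul_comm, intervalIntegral.integral_of_le hT0.le,
        integral_Ioc_eq_integral_Ioo]
    simp only [smul_sub]
    rw [integral_sub i1 i2, e1, e2]
    refine Eq.trans ?_ hc
    rw [sub_eq_add_neg, ← integral_neg]
    simp [hχ, U])
  have key2 : ∀ᵐ p ∂(volume.restrict U), ξ (Y p.1 p.2) p.2 - ξ₀ p.1 = 0 := by
    rw [ae_restrict_iff' hUm]
    exact key
  have hs : MeasurePreserving F.Θ.symm (volume.restrict U) (volume.restrict U) :=
    hmpU.symm F.Θ.toMeasurableEquiv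
  filter_upwards [hs.quasiMeasurePreserving.ae key2] with p hp
  have h3 : F.Θ.symm p = (Yi p.1 p.2, p.2) := rfl
  rw [h3] at hp
  simp only [F.hr] at hp
  linarith
end NiceFlow


lemma caratheodory (T0 : ℝ) (F : E3 → ℝ → E3)
    (hm : ∀ a, AEStronglyMeasurable (F a) (volume.restrict (Ioo 0 T0)))
    (P : ℝ → Prop) (hP : ∀ᵐ t ∂(volume.restrict (Ioo 0 T0)), P t)
    (hPc : ∀ t ∈ Ioo 0 T0, P t → Continuous fun a => F a t) :
    ∃ S : Set ℝ, MeasurableSet S ∧ S ⊆ Ioo 0 T0 ∧ (∀ᵐ t ∂(volume.restrict (Ioo 0 T0)), t ∈ S) ∧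
      (∀ t ∈ S, P t) ∧ Measurable (fun p : E3 × ℝ => S.indicator (F p.1) p.2) := by
  let d := TopologicalSpace.denseSeq E3
  have h1 : ∀ᵐ t ∂(volume.restrict (Ioo 0 T0)), t ∈ Ioo 0 T0 ∧ P t ∧
      ∀ n, F (d n) t = (hm (d n)).mk _ t :=
    (ae_restrict_mem measurableSet_Ioo).and (hP.and (ae_all_iff.2 fun n => (hm (d n)).ae_eq_mk))
  obtain ⟨S, hS, hSm, hSp⟩ := h1.exists_measurable_mem
  have hcont : ∀ t, Continuous fun a => S.indicator (F a) t := by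
    intro t
    by_cases ht : t ∈ S
    · simpa [ht] using hPc t (hSp t ht).1 (hSp t ht).2.1
    · simpa [ht] using continuous_const
  refine ⟨S, hSm, fun t ht => (hSp t ht).1, hS, fun t ht => (hSp t ht).2.1, ?_⟩
  refine measurable_uncurry_of_continuous_of_measurable (u := fun a t => S.indicator (F a) t)
    hcont ?_
  have hd : ∀ n, Measurable (S.indicator (F (d n))) := by
    intro n
    have : S.indicator (F (d n)) = S.indicator ((hm (d n)).mk _) := by
      ext1 t
      by_cases ht : t ∈ S
      · simp only [indicator_of_mem ht]
        exact (hSp t ht).2.2 n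
      · simp [ht]
    rw [this]
    exact (hm (d n)).stronglyMeasurable_mk.measurable.indicator hSm
  intro a
  have ha : a ∈ closure (range d) := TopologicalSpace.denseRange_denseSeq E3 a
  obtain ⟨x, hx, hxa⟩ := mem_closure_iff_seq_limit.1 ha
  refine measurable_of_tendsto_metrizable (f := fun n => S.indicator (F (x n))) (fun n => ?_) ?_
  · obtain ⟨k, hk⟩ := hx n
    rw [← hk]
    exact hd k
  · rw [tendsto_pi_nhds]
    intro t
    exact ((hcont t).tendsto a).comp hxa

lemma loglip_modulus {γ Cu r : ℝ} (hγ : 0 < γ) (hCu : 0 < Cu) (hr0 : 0 ≤ r) (hr : r ≤ 1) :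
    Cu * r * Real.log (2 + 1 / r) ≤ (Cu * (3 ^ (γ / 2) / (γ / 2))) * r ^ (1 - γ / 2) := by
  rcases hr0.eq_or_lt with h | h
  · rw [← h]
    simp only [mul_zero, zero_mul]
    positivity
  · have h1 : Real.log (2 + 1 / r) ≤ Real.log (3 / r) := by
      apply Real.log_le_log (by positivity)
      have : 1 ≤ 1 / r := by rw [le_div_iff₀ h]; linarith
      have h3 : 3 / r = 3 * (1 / r) := by ring
      rw [h3]; linarith
    have h2 := Real.log_le_rpow_div (x := 3 / r) (ε := γ / 2) (by positivity) (by positivity)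
    have h3 : (3 / r) ^ (γ / 2) = 3 ^ (γ / 2) / r ^ (γ / 2) := Real.div_rpow (by norm_num) hr0 _
    have h4 : r ^ (1 - γ / 2) = r / r ^ (γ / 2) := by
      rw [Real.rpow_sub h, Real.rpow_one]
    have h5 : 0 < r ^ (γ / 2) := Real.rpow_pos_of_pos h _
    calc Cu * r * Real.log (2 + 1 / r) ≤ Cu * r * ((3 / r) ^ (γ / 2) / (γ / 2)) := by
          gcongr; exact h1.trans h2
      _ = _ := by rw [h3, h4]; field_simp

lemma continuous_of_modulus {α C : ℝ} (hα : 0 < α) (f : E3 → E3)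
    (h : ∀ x y, ‖x - y‖ ≤ 1 → ‖f x - f y‖ ≤ C * ‖x - y‖ ^ α) : Continuous f := by
  rw [continuous_iff_continuousAt]
  intro y
  rw [ContinuousAt, tendsto_iff_norm_sub_tendsto_zero]
  have h0 : Tendsto (fun x => C * ‖x - y‖ ^ α) (nhds y) (nhds 0) := by
    have : Continuous (fun x => C * ‖x - y‖ ^ α) := by
      refine continuous_const.mul (Continuous.rpow_const (by fun_prop) fun _ => Or.inr hα.le)
    have h1 := this.tendsto y
    simpa [Real.zero_rpow hα.ne'] using h1
  refine squeeze_zero' (Eventually.of_forall fun _ => norm_nonneg _) ?_ h0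
  filter_upwards [Metric.ball_mem_nhds y one_pos] with x hx
  exact h x y (by rw [mem_ball_iff_norm] at hx; exact hx.le)

lemma integral_fderiv_zero (ρ : E3 → ℝ) (hρ : ContDiff ℝ (⊤ : ℕ∞) ρ) (hρc : HasCompactSupport ρ)
    (w : E3) : ∫ z, fderiv ℝ ρ z w = 0 := by
  have hi : Integrable (fun z => fderiv ℝ ρ z w) volume := by
    refine Continuous.integrable_of_hasCompactSupport
      ((hρ.continuous_fderiv (by simp)).clm_apply continuous_const) ?_
    refine (hρc.fderiv ℝ).mono ?_
    intro y hy hy'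
    exact hy (by simp only [hy']; rfl)
  have := integral_mul_fderiv_eq_neg_fderiv_mul_of_integrable (μ := (volume : Measure E3))
    (f := fun _ => (1:ℝ)) (g := ρ) (v := w) (by simp) (by simpa using hi)
    (by simpa using hρ.continuous.integrable_of_hasCompactSupport hρc)
    (fun x _ => by fun_prop) (fun x _ => (hρ.differentiable (by simp)) x)
  simpa using this

lemma hdiv_aux {T0 M : ℝ} (u : E3 → ℝ → E3)
    (hum : Measurable (fun p : E3 × ℝ => u p.1 p.2))
    (hub : ∀ x t, ‖u x t‖ ≤ M) (huc : ∀ t, Continuous fun x => u x t)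
    (hdiv : ∀ φ : E3 × ℝ → ℝ, ContDiff ℝ (⊤ : ℕ∞) φ → HasCompactSupport φ →
      tsupport φ ⊆ (univ : Set E3) ×ˢ Ioo 0 T0 →
      (∫ p : E3 × ℝ in (univ : Set E3) ×ˢ Ioo 0 T0,
          fderiv ℝ (fun y => φ (y, p.2)) p.1 (u p.1 p.2)) = 0)
    (ρ : E3 → ℝ) (hρ : ContDiff ℝ (⊤ : ℕ∞) ρ) (hρc : HasCompactSupport ρ) :
    ∀ᵐ t ∂(volume.restrict (Ioo 0 T0)), ∀ x, ∫ y, fderiv ℝ ρ (x - y) (u x t - u y t) = 0 := by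
  have hM : 0 ≤ M := (norm_nonneg _).trans (hub 0 0)
  have hμ : (volume.restrict ((univ : Set E3) ×ˢ Ioo 0 T0) : Measure (E3 × ℝ))
      = (volume : Measure E3).prod (volume.restrict (Ioo 0 T0)) := by
    rw [Measure.volume_eq_prod, ← Measure.prod_restrict, Measure.restrict_univ]
  have hDi : Integrable (fun z => ‖fderiv ℝ ρ z‖) volume :=
    ((hρ.continuous_fderiv (by simp)).integrable_of_hasCompactSupport (hρc.fderiv ℝ)).norm
  have stepA : ∀ x : E3, ∀ᵐ t ∂(volume.restrict (Ioo 0 T0)),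
      ∫ y, fderiv ℝ ρ (x - y) (u y t) = 0 := by
    intro x
    have hint : Integrable (fun p : E3 × ℝ => fderiv ℝ ρ (x - p.1) (u p.1 p.2))
        ((volume : Measure E3).prod (volume.restrict (Ioo 0 T0))) := by
      have h1 : Integrable (fun p : E3 × ℝ => ‖fderiv ℝ ρ (x - p.1)‖ * M)
        ((volume : Measure E3).prod (volume.restrict (Ioo 0 T0))) :=
        ((hDi.comp_sub_left x).mul_const M).comp_fst _
      refine h1.mono' ?_ (Eventually.of_forall fun p => ?_)
      · exact ((continuous_fderiv_pair ρ hρ).measurable.comp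
          ((measurable_const.sub measurable_fst).prodMk hum)).aestronglyMeasurable
      · refine (ContinuousLinearMap.le_opNorm _ _).trans ?_
        gcongr
        exact hub _ _
    have key := (isOpen_Ioo (a := (0:ℝ)) (b := T0)).ae_eq_zero_of_integral_contDiff_smul_eq_zero
      (μ := volume) (f := fun t => ∫ y, fderiv ℝ ρ (x - y) (u y t)) (by
        have := hint.integral_prod_right
        exact IntegrableOn.locallyIntegrableOn this) (by
        intro h hh hhc hht
        have hg : ContDiff ℝ (⊤ : ℕ∞) (fun y => ρ (x - y)) := hρ.comp (contDiff_const.sub contDiff_id)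
        have hgc : HasCompactSupport (fun y => ρ (x - y)) :=
          hρc.comp_homeomorph (Homeomorph.subLeft x)
        have hts : tsupport (fun p : E3 × ℝ => ρ (x - p.1) * h p.2) ⊆
            tsupport (fun y => ρ (x - y)) ×ˢ tsupport h := by
          refine closure_minimal ?_ ((isClosed_tsupport _).prod (isClosed_tsupport _))
          intro p hp
          exact ⟨subset_tsupport _ (left_ne_zero_of_mul hp),
            subset_tsupport _ (right_ne_zero_of_mul hp)⟩
        have h0 := hdiv (fun p => ρ (x - p.1) * h p.2)
          ((hg.comp contDiff_fst).mul (hh.comp contDiff_snd))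
          (IsCompact.of_isClosed_subset (IsCompact.prod hgc hhc) (isClosed_tsupport _) hts)
          (hts.trans (Set.prod_mono (subset_univ _) hht))
        have hd : ∀ p : E3 × ℝ, fderiv ℝ (fun y => ρ (x - y) * h p.2) p.1 (u p.1 p.2) =
            - (h p.2 * fderiv ℝ ρ (x - p.1) (u p.1 p.2)) := by
          intro p
          have h1 : HasFDerivAt (fun y => ρ (x - y))
              ((fderiv ℝ ρ (x - p.1)).comp (-(ContinuousLinearMap.id ℝ E3))) p.1 :=
            ((hρ.differentiable (by simp)) (x - p.1)).hasFDerivAt.comp p.1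
              ((hasFDerivAt_id p.1).const_sub x)
          rw [(h1.mul_const (h p.2)).fderiv]
          simp
        simp only [hd] at h0
        rw [integral_neg, neg_eq_zero, hμ] at h0
        obtain ⟨Ch, hCh⟩ := hhc.exists_bound_of_continuous hh.continuous
        rw [integral_prod_symm _ (hint.bdd_mul (f := fun p : E3 × ℝ => h p.2) (c := Ch)
          (hh.continuous.comp continuous_snd).aestronglyMeasurable
          (Eventually.of_forall fun p => hCh _))] at h0
        simp only [integral_const_mul] at h0
        simp only [smul_eq_mul]
        rw [← setIntegral_eq_integral_of_forall_compl_eq_zero (s := Ioo 0 T0)]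
        · exact h0
        · intro t ht
          rw [image_eq_zero_of_notMem_tsupport (f := h) fun h' => ht (hht h'), zero_mul])
    rw [ae_restrict_iff' measurableSet_Ioo]
    exact key
  have stepB := ae_all_iff.2 fun n => stepA (TopologicalSpace.denseSeq E3 n)
  filter_upwards [stepB] with t ht
  have hsub : ∀ x, ∫ y, fderiv ℝ ρ (x - y) (u y t) = ∫ z, fderiv ℝ ρ z (u (x - z) t) := by
    intro x
    rw [← integral_sub_left_eq_self _ volume x]
    simp
  have hcont : Continuous fun x => ∫ y, fderiv ℝ ρ (x - y) (u y t) := by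
    simp only [hsub]
    refine continuous_of_dominated (bound := fun z => ‖fderiv ℝ ρ z‖ * M) ?_ ?_
      (hDi.mul_const M) ?_
    · intro x
      exact ((continuous_fderiv_pair ρ hρ).comp (continuous_id.prodMk
        ((huc t).comp (continuous_const.sub continuous_id)))).aestronglyMeasurable
    · intro x
      refine Eventually.of_forall fun z => ?_
      refine (ContinuousLinearMap.le_opNorm _ _).trans ?_
      gcongr
      exact hub _ _
    · refine Eventually.of_forall fun z => ?_
      exact (fderiv ℝ ρ z).continuous.comp ((huc t).comp (continuous_id.sub continuous_const))
  have hz := (TopologicalSpace.denseRange_denseSeq E3).equalizer hcont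
    (continuous_const (y := (0:ℝ))) (funext fun n => ht n)
  intro x
  have i1 := integrable_Dρ ρ hρ hρc (fun _ => 1) continuous_const x (fun _ => u x t) continuous_const
  have i2 := integrable_Dρ ρ hρ hρc (fun _ => 1) continuous_const x (fun y => u y t) (huc t)
  simp only [one_mul] at i1 i2
  simp only [map_sub]
  rw [integral_sub i1 i2]
  have e1 : ∫ y, fderiv ℝ ρ (x - y) (u x t) = 0 := by
    rw [integral_sub_left_eq_self (fun z => fderiv ℝ ρ z (u x t)) volume x]
    exact integral_fderiv_zero ρ hρ hρc _
  rw [e1, congrFun hz x, sub_zero]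


lemma ae_bound {T0 M : ℝ} (u : E3 → ℝ → E3)
    (h : ∀ᵐ p : E3 × ℝ ∂(volume.restrict ((univ : Set E3) ×ˢ Ioo 0 T0)), ‖u p.1 p.2‖ ≤ M)
    (hc : ∀ᵐ t ∂(volume.restrict (Ioo 0 T0)), Continuous fun x => u x t) :
    ∀ᵐ t ∂(volume.restrict (Ioo 0 T0)), ∀ x, ‖u x t‖ ≤ M := by
  rw [Measure.volume_eq_prod, ← Measure.prod_restrict, Measure.restrict_univ] at h
  have h2 := (Measure.measurePreserving_swap (μ := (volume.restrict (Ioo 0 T0) : Measure ℝ))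
    (ν := (volume : Measure E3))).quasiMeasurePreserving.ae h
  have h3 := Measure.ae_ae_of_ae_prod h2
  filter_upwards [h3, hc] with t ht htc x
  have hd := Measure.dense_of_ae ht
  have hcl : IsClosed {x | ‖u x t‖ ≤ M} := isClosed_le htc.norm continuous_const
  have : x ∈ closure {x | ‖u x t‖ ≤ M} := hd x
  rwa [hcl.closure_eq] at this

lemma exists_nice (T0 : ℝ) (hT0 : 0 < T0)
    (u : E3 → ℝ → E3)
    (hubdd : ∃ M : ℝ, ∀ᵐ p : E3 × ℝ ∂(volume.restrict ((univ : Set E3) ×ˢ Ioo 0 T0)),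
      ‖u p.1 p.2‖ ≤ M)
    (hdiv : ∀ φ : E3 × ℝ → ℝ, ContDiff ℝ (⊤ : ℕ∞) φ → HasCompactSupport φ →
      tsupport φ ⊆ (univ : Set E3) ×ˢ Ioo 0 T0 →
      (∫ p : E3 × ℝ in (univ : Set E3) ×ˢ Ioo 0 T0,
          fderiv ℝ (fun y => φ (y, p.2)) p.1 (u p.1 p.2)) = 0)
    (Y Yinv : E3 → ℝ → E3)
    (hYode : ∀ a : E3, ∀ t ∈ Icc (0 : ℝ) T0,
      IntervalIntegrable (fun s => u (Y a s) s) volume 0 t ∧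
      Y a t = a + ∫ s in (0 : ℝ)..t, u (Y a s) s)
    (hYhomeo : ∀ t ∈ Icc (0 : ℝ) T0,
      Continuous (fun a => Y a t) ∧ Continuous (fun x => Yinv x t) ∧
      (∀ a : E3, Yinv (Y a t) t = a) ∧ (∀ x : E3, Y (Yinv x t) t = x) ∧
      MeasurePreserving (fun a => Y a t) volume volume)
    (hHolder : ∃ γ ∈ Ioc (0 : ℝ) 1, ∀ K : Set E3, IsCompact K →
      ∃ C : ℝ, ∀ t ∈ Icc (0 : ℝ) T0, ∀ x ∈ K, ∀ y ∈ K,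
        ‖Y x t - Y y t‖ ≤ C * ‖x - y‖ ^ γ ∧ ‖Yinv x t - Yinv y t‖ ≤ C * ‖x - y‖ ^ γ)
    (hLL : ∃ Cu : ℝ, 0 < Cu ∧ ∀ᵐ t ∂(volume.restrict (Ioo 0 T0)), ∀ x y : E3,
      ‖u x t - u y t‖ ≤ Cu * ‖x - y‖ * Real.log (2 + 1 / ‖x - y‖)) :
    ∃ (M γ Cω : ℝ) (v Z Zi : E3 → ℝ → E3), NiceFlow T0 M γ Cω v Z Zi ∧
      (∀ᵐ p : E3 × ℝ ∂(volume.restrict ((univ : Set E3) ×ˢ Ioo 0 T0)), v p.1 p.2 = u p.1 p.2) ∧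
      ∀ x, ∀ t ∈ Ioo 0 T0, Zi x t = Yinv x t := by
  obtain ⟨M', hM'⟩ := hubdd
  obtain ⟨γ, ⟨hγ, hγ1⟩, hH⟩ := hHolder
  obtain ⟨Cu, hCu, hLL⟩ := hLL
  set M := max M' 0 with hMdef
  have hM0 : 0 ≤ M := le_max_right _ _
  set Cω := Cu * (3 ^ (γ / 2) / (γ / 2)) with hCωdef
  have hCω : 0 ≤ Cω := by rw [hCωdef]; positivity
  have hα : 0 < 1 - γ / 2 := by linarith
  have hmod : ∀ᵐ t ∂(volume.restrict (Ioo 0 T0)), ∀ x y : E3, ‖x - y‖ ≤ 1 →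
      ‖u x t - u y t‖ ≤ Cω * ‖x - y‖ ^ (1 - γ / 2) := by
    filter_upwards [hLL] with t ht x y hxy
    exact (ht x y).trans (loglip_modulus hγ hCu (norm_nonneg _) hxy)
  have hcont : ∀ᵐ t ∂(volume.restrict (Ioo 0 T0)), Continuous fun x => u x t := by
    filter_upwards [hmod] with t ht
    exact continuous_of_modulus hα _ ht
  have hbd : ∀ᵐ t ∂(volume.restrict (Ioo 0 T0)), ∀ x, ‖u x t‖ ≤ M := by
    filter_upwards [ae_bound u hM' hcont] with t ht x
    exact (ht x).trans (le_max_left _ _)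
  obtain ⟨S, hSm, hSI, hSae, hSP, hSmeas⟩ := caratheodory T0 (fun a t => u (Y a t) t)
    (fun a => by
      have := (hYode a T0 ⟨hT0.le, le_rfl⟩).1.1
      exact (this.mono_set Ioo_subset_Ioc_self).aestronglyMeasurable)
    (fun t => (∀ x y : E3, ‖x - y‖ ≤ 1 → ‖u x t - u y t‖ ≤ Cω * ‖x - y‖ ^ (1 - γ / 2)) ∧
      (∀ x, ‖u x t‖ ≤ M)) (hmod.and hbd)
    (fun t ht h => (continuous_of_modulus hα _ h.1).comp (hYhomeo t (Ioo_subset_Icc_self ht)).1)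
  let pr : ℝ → ℝ := fun t => (projIcc 0 T0 hT0.le t : ℝ)
  have hprc : Continuous pr := continuous_subtype_val.comp continuous_projIcc
  have hprm : ∀ t, pr t ∈ Icc 0 T0 := fun t => (projIcc 0 T0 hT0.le t).2
  have hpri : ∀ t ∈ Icc 0 T0, pr t = t := fun t ht => by
    simp only [pr, projIcc_of_mem hT0.le ht]
  let Z : E3 → ℝ → E3 := fun a t => Y a (pr t)
  let Zi : E3 → ℝ → E3 := fun a t => Yinv a (pr t)
  let v : E3 → ℝ → E3 := fun x t => S.indicator (u x) t
  have hSIcc : ∀ t ∈ S, t ∈ Icc 0 T0 := fun t ht => Ioo_subset_Icc_self (hSI ht)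
  have hvS : ∀ x, ∀ t ∈ S, v x t = u x t := fun x t ht => indicator_of_mem ht _
  have hvS' : ∀ x, ∀ t, t ∉ S → v x t = 0 := fun x t ht => indicator_of_notMem ht _
  have hvb : ∀ x t, ‖v x t‖ ≤ M := by
    intro x t
    by_cases ht : t ∈ S
    · rw [hvS x t ht]; exact (hSP t ht).2 x
    · rw [hvS' x t ht, norm_zero]; exact hM0
  have hvm : ∀ t x y, ‖x - y‖ ≤ 1 → ‖v x t - v y t‖ ≤ Cω * ‖x - y‖ ^ (1 - γ / 2) := by
    intro t x y hxy
    by_cases ht : t ∈ S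
    · rw [hvS x t ht, hvS y t ht]; exact (hSP t ht).1 x y hxy
    · rw [hvS' x t ht, hvS' y t ht, sub_zero, norm_zero]; positivity
  have hvc : ∀ t, Continuous fun x => v x t := fun t => continuous_of_modulus hα _ (hvm t)
  -- the equation
  have hae : ∀ᵐ s ∂(volume : Measure ℝ), s ∈ Ioc 0 T0 → s ∈ S := by
    have h1 : ∀ᵐ s ∂(volume.restrict (Ioc 0 T0) : Measure ℝ), s ∈ S := by
      rw [← Measure.restrict_congr_set Ioo_ae_eq_Ioc]; exact hSae
    exact (ae_restrict_iff' measurableSet_Ioc).1 h1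
  have hint : ∀ a s t, IntervalIntegrable (fun s => v (Z a s) s) volume s t := by
    intro a s t
    have h1 : Integrable (fun s => v (Z a s) s) volume := by
      have h2 : IntegrableOn (fun s => u (Y a s) s) (Ioc 0 T0) volume :=
        (hYode a T0 ⟨hT0.le, le_rfl⟩).1.1
      have h3 : Integrable (S.indicator (fun s => u (Y a s) s)) volume := by
        rw [integrable_indicator_iff hSm]
        exact h2.mono_set (hSI.trans Ioo_subset_Ioc_self)
      refine h3.congr (Eventually.of_forall fun s => ?_)
      by_cases hs : s ∈ S
      · simp only [hvS _ s hs, indicator_of_mem hs, Z, hpri s (hSIcc s hs)]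
      · simp only [hvS' _ s hs, indicator_of_notMem hs]
    exact h1.intervalIntegrable
  have hode : ∀ a t, Z a t = a + ∫ s in (0:ℝ)..t, v (Z a s) s := by
    intro a t
    have h1 : ∫ s in (0:ℝ)..t, v (Z a s) s = ∫ s in (0:ℝ)..(pr t), v (Z a s) s := by
      rw [← sub_eq_zero, intervalIntegral.integral_interval_sub_left (hint a _ _) (hint a _ _)]
      refine intervalIntegral.integral_zero_ae ?_
      refine Eventually.of_forall fun s hs => ?_
      refine hvS' _ s fun hsS => ?_
      have hsI := hSI hsS
      rcases le_total t 0 with h | h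
      · have : pr t = 0 := by simp only [pr, projIcc_of_le_left hT0.le h]
        rw [this, uIoc_of_ge h] at hs
        exact absurd hs.2 (not_le.2 hsI.1)
      · rcases le_total T0 t with h' | h'
        · have : pr t = T0 := by simp only [pr, projIcc_of_right_le hT0.le h']
          rw [this, uIoc_of_le h'] at hs
          exact absurd hs.1 (not_lt.2 hsI.2.le)
        · rw [hpri t ⟨h, h'⟩] at hs
          simp at hs
    rw [h1]
    have h2 := (hYode a (pr t) (hprm t)).2
    refine Eq.trans h2 ?_
    congr 1
    refine intervalIntegral.integral_congr_ae ?_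
    filter_upwards [hae] with s hs hs'
    rw [uIoc_of_le (hprm t).1] at hs'
    have hsS := hs ⟨hs'.1, hs'.2.trans (hprm t).2⟩
    rw [hvS _ s hsS]
    simp only [Z, hpri s (hSIcc s hsS)]
  have hlip : ∀ a, LipschitzWith M.toNNReal (fun t => Z a t) := by
    intro a
    refine LipschitzWith.of_dist_le_mul fun t s => ?_
    rw [Real.coe_toNNReal _ hM0, dist_eq_norm, hode a t, hode a s, add_sub_add_left_eq_sub,
      intervalIntegral.integral_interval_sub_left (hint a _ _) (hint a _ _), Real.dist_eq]
    exact intervalIntegral.norm_integral_le_of_norm_le_const fun r _ => hvb _ _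
  have hZc : Continuous (fun p : E3 × ℝ => Z p.1 p.2) :=
    continuous_prod_of_continuous_lipschitzWith' _ M.toNNReal hlip
      (fun t => (hYhomeo _ (hprm t)).1)
  have hl : ∀ a t, Zi (Z a t) t = a := fun a t => (hYhomeo _ (hprm t)).2.2.1 a
  have hr : ∀ a t, Z (Zi a t) t = a := fun a t => (hYhomeo _ (hprm t)).2.2.2.1 a
  have hH' : ∀ K : Set E3, IsCompact K → ∃ C : ℝ, 0 ≤ C ∧ ∀ t, ∀ x ∈ K, ∀ y ∈ K,
      ‖Zi x t - Zi y t‖ ≤ C * ‖x - y‖ ^ γ := by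
    intro K hK
    obtain ⟨C, hC⟩ := hH K hK
    refine ⟨max C 0, le_max_right _ _, fun t x hx y hy => ?_⟩
    refine ((hC _ (hprm t) x hx y hy).2).trans ?_
    gcongr
    exact le_max_left _ _
  have hZic : Continuous (fun p : E3 × ℝ => Zi p.1 p.2) := by
    rw [continuous_iff_continuousAt]
    rintro ⟨x0, t0⟩
    set a0 := Zi x0 t0 with ha0
    obtain ⟨C, hC0, hC⟩ := hH' _ (isCompact_closedBall x0 1)
    rw [ContinuousAt, tendsto_iff_norm_sub_tendsto_zero]
    have hZ0 : Continuous fun p : E3 × ℝ => Z a0 p.2 :=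
      hZc.comp (continuous_const.prodMk continuous_snd)
    have h0 : Tendsto (fun p : E3 × ℝ => C * ‖p.1 - Z a0 p.2‖ ^ γ) (nhds (x0, t0)) (nhds 0) := by
      have : Continuous (fun p : E3 × ℝ => C * ‖p.1 - Z a0 p.2‖ ^ γ) :=
        continuous_const.mul (Continuous.rpow_const (continuous_fst.sub hZ0).norm
          fun _ => Or.inr hγ.le)
      have h1 := this.tendsto (x0, t0)
      simpa [ha0, hr, Real.zero_rpow hγ.ne'] using h1
    refine squeeze_zero' (Eventually.of_forall fun _ => norm_nonneg _) ?_ h0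
    have e1 : ∀ᶠ p : E3 × ℝ in nhds (x0, t0), p.1 ∈ Metric.closedBall x0 1 :=
      continuous_fst.continuousAt.eventually (Metric.closedBall_mem_nhds x0 one_pos)
    have e2 : ∀ᶠ p : E3 × ℝ in nhds (x0, t0), Z a0 p.2 ∈ Metric.closedBall x0 1 := by
      refine hZ0.continuousAt.eventually ?_
      simp only [ha0, hr]
      exact Metric.closedBall_mem_nhds x0 one_pos
    filter_upwards [e1, e2] with p h1 h2
    have := hC p.2 p.1 h1 _ h2
    rwa [hl] at this
  have hum : Measurable (fun p : E3 × ℝ => v p.1 p.2) := by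
    have h1 := hSmeas.comp (hZic.prodMk continuous_snd).measurable
    have h2 : (fun p : E3 × ℝ => v p.1 p.2) =
        (fun p : E3 × ℝ => S.indicator (fun t => u (Y p.1 t) t) p.2) ∘
          (fun p : E3 × ℝ => (Zi p.1 p.2, p.2)) := by
      ext1 p
      by_cases hp : p.2 ∈ S
      · have h3 := hr p.1 p.2
        simp only [Z, hpri _ (hSIcc _ hp)] at h3
        simp only [hvS _ _ hp, Function.comp, indicator_of_mem hp, h3]
      · simp only [hvS' _ _ hp, Function.comp, indicator_of_notMem hp]
    rw [h2]
    exact h1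
  have hveq : ∀ᵐ p : E3 × ℝ ∂(volume.restrict ((univ : Set E3) ×ˢ Ioo 0 T0)),
      v p.1 p.2 = u p.1 p.2 := by
    rw [Measure.volume_eq_prod, ← Measure.prod_restrict, Measure.restrict_univ]
    filter_upwards [Measure.quasiMeasurePreserving_snd.ae hSae] with p hp
    exact hvS _ _ hp
  have hdiv' : ∀ φ : E3 × ℝ → ℝ, ContDiff ℝ (⊤ : ℕ∞) φ → HasCompactSupport φ →
      tsupport φ ⊆ (univ : Set E3) ×ˢ Ioo 0 T0 →
      (∫ p : E3 × ℝ in (univ : Set E3) ×ˢ Ioo 0 T0,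
          fderiv ℝ (fun y => φ (y, p.2)) p.1 (v p.1 p.2)) = 0 := by
    intro φ h1 h2 h3
    refine Eq.trans ?_ (hdiv φ h1 h2 h3)
    refine integral_congr_ae ?_
    filter_upwards [hveq] with p hp
    rw [hp]
  refine ⟨M, γ, Cω, v, Z, Zi, ?_, hveq, ?_⟩
  · exact {
      hM := hM0, hγ := hγ, hγ1 := hγ1, hum := hum, hub := hvb, huc := hvc, hCω := hCω
      hω := hvm, hYc := hZc, hYic := hZic, hl := hl, hr := hr
      hmp := fun t => (hYhomeo _ (hprm t)).2.2.2.2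
      hode := hode, hH := hH'
      hdiv := fun ρ h1 h2 => hdiv_aux v hum hvb hvc hdiv' ρ h1 h2 }
  · intro x t ht
    simp only [Zi, hpri t (Ioo_subset_Icc_self ht)]

/-- Cauchy formula: transport by a given flow.  Let `T₀ > 0` and let
`u ∈ L^∞((0,T₀) × ℝ³)` be divergence-free in the sense of distributions.  Let `Y` be a
flow map of `u`:  (i) for every `a`, `t ↦ Y(a,t)` is absolutely continuous with
`Y(a,0) = a` and `∂_t Y(a,t) = u(Y(a,t),t)` a.e. (encoded by the integral identity);
(ii) each `Y_t` is a measure-preserving homeomorphism of `ℝ³` (with inverse `Yinv`);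
(iii) `Y_t` and `Y_t⁻¹` are uniformly `γ`-Hölder on compact sets.  Let `ξ₀ ∈ L¹(ℝ³)` and
let `ξ ∈ L¹_loc([0,T₀) × ℝ³)` with `u ξ ∈ L¹_loc` satisfy the distributional transport
identity with initial data `ξ₀`.  If moreover `u` is log-Lipschitz in space, uniformly
for a.e. `t`, then `ξ(x,t) = ξ₀(Y_t⁻¹(x))` for a.e. `(x,t) ∈ ℝ³ × (0,T₀)`. -/
theorem transport_by_flow_cauchy_formula (T0 : ℝ) (hT0 : 0 < T0)
    (u : E3 → ℝ → E3)
    (hubdd : ∃ M : ℝ, ∀ᵐ p : E3 × ℝ ∂(volume.restrict ((univ : Set E3) ×ˢ Ioo 0 T0)),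
      ‖u p.1 p.2‖ ≤ M)
    (hdiv : ∀ φ : E3 × ℝ → ℝ, ContDiff ℝ (⊤ : ℕ∞) φ → HasCompactSupport φ →
      tsupport φ ⊆ (univ : Set E3) ×ˢ Ioo 0 T0 →
      (∫ p : E3 × ℝ in (univ : Set E3) ×ˢ Ioo 0 T0,
          fderiv ℝ (fun y => φ (y, p.2)) p.1 (u p.1 p.2)) = 0)
    (Y Yinv : E3 → ℝ → E3)
    (hY0 : ∀ a : E3, Y a 0 = a)
    (hYode : ∀ a : E3, ∀ t ∈ Icc (0 : ℝ) T0,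
      IntervalIntegrable (fun s => u (Y a s) s) volume 0 t ∧
      Y a t = a + ∫ s in (0 : ℝ)..t, u (Y a s) s)
    (hYhomeo : ∀ t ∈ Icc (0 : ℝ) T0,
      Continuous (fun a => Y a t) ∧ Continuous (fun x => Yinv x t) ∧
      (∀ a : E3, Yinv (Y a t) t = a) ∧ (∀ x : E3, Y (Yinv x t) t = x) ∧
      MeasurePreserving (fun a => Y a t) volume volume)
    (hHolder : ∃ γ ∈ Ioc (0 : ℝ) 1, ∀ K : Set E3, IsCompact K →
      ∃ C : ℝ, ∀ t ∈ Icc (0 : ℝ) T0, ∀ x ∈ K, ∀ y ∈ K,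
        ‖Y x t - Y y t‖ ≤ C * ‖x - y‖ ^ γ ∧ ‖Yinv x t - Yinv y t‖ ≤ C * ‖x - y‖ ^ γ)
    (ξ₀ : E3 → ℝ) (hξ₀ : Integrable ξ₀ volume)
    (ξ : E3 → ℝ → ℝ)
    (hξloc : LocallyIntegrableOn (fun p : E3 × ℝ => ξ p.1 p.2)
      ((univ : Set E3) ×ˢ Ico 0 T0) volume)
    (huξloc : LocallyIntegrableOn (fun p : E3 × ℝ => ξ p.1 p.2 • u p.1 p.2)
      ((univ : Set E3) ×ˢ Ico 0 T0) volume)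
    (htransport : ∀ ψ : E3 × ℝ → ℝ, ContDiff ℝ (⊤ : ℕ∞) ψ → HasCompactSupport ψ →
      tsupport ψ ⊆ (univ : Set E3) ×ˢ Iio T0 →
      (∫ p : E3 × ℝ in (univ : Set E3) ×ˢ Ioo 0 T0,
          ξ p.1 p.2 *
            (deriv (fun s => ψ (p.1, s)) p.2 +
              fderiv ℝ (fun y => ψ (y, p.2)) p.1 (u p.1 p.2)))
        + (∫ x : E3, ξ₀ x * ψ (x, 0)) = 0)
    (hLL : ∃ Cu : ℝ, 0 < Cu ∧ ∀ᵐ t ∂(volume.restrict (Ioo 0 T0)), ∀ x y : E3,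
      ‖u x t - u y t‖ ≤ Cu * ‖x - y‖ * Real.log (2 + 1 / ‖x - y‖)) :
    ∀ᵐ p : E3 × ℝ ∂(volume.restrict ((univ : Set E3) ×ˢ Ioo 0 T0)),
      ξ p.1 p.2 = ξ₀ (Yinv p.1 p.2) := by
  obtain ⟨M, γ, Cω, v, Z, Zi, F, hv, hZi⟩ :=
    exists_nice T0 hT0 u hubdd hdiv Y Yinv hYode hYhomeo hHolder hLL
  have h := F.final hT0 ξ₀ hξ₀ ξ hξloc (by
    intro ψ h1 h2 h3
    refine Eq.trans ?_ (htransport ψ h1 h2 h3)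
    congr 1
    refine integral_congr_ae ?_
    filter_upwards [hv] with p hp
    rw [hp])
  filter_upwards [h, ae_restrict_mem (MeasurableSet.univ.prod measurableSet_Ioo)] with p hp hpU
  rw [hp, hZi _ _ hpU.2]
end
end

section
/- Fix 2/7 <= alpha < 1 and 0 < epsilon <= 1. Let x_k : [0,infty) -> (0,infty), k = 1, 2, 3, ..., be differentiable functions with x_k(0) = epsilon k^{-alpha}, satisfying for every k >= 1 and t >= 0 the triangular ODE system x_k'(t) = x_k(t) Sum_{j=1}^{k-1} x_j(t) Gamma_j(t)^2 (empty sum = 0 for k = 1), where Gamma_j(t) := (x_j(0)/x_j(t))^3. Then for every t > 0 and every k >= 2, x_k(t) <= (epsilon / k^alpha) (1 + (e^{5t/2} - 1) epsilon Sum_{j=1}^{k-1} j^{-alpha})^{2/5}. In particular, for every fixed t > 0 the family {x_k(t)}_{k >= 1} is bounded, and if alpha > 2/7 then x_k(t) -> 0 as k -> infty. -/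
noncomputable section

open Real Set Finset Filter

/-- The aspect ratio `Γ_j(t) = (x_j(0)/x_j(t))³`. -/
def Gam (x : ℕ → ℝ → ℝ) (j : ℕ) (t : ℝ) : ℝ := (x j 0 / x j t) ^ 3

lemma aux_sum (s : ℕ → ℝ) (h0 : ∀ j, 1 ≤ j → 0 ≤ s j) (h1 : ∀ j, 1 ≤ j → s j ≤ 1) (n : ℕ) :
    (∑ j ∈ Finset.Icc 1 n, s j) ^ 2 - ∑ j ∈ Finset.Icc 1 n, s j ≤
      2 * ∑ j ∈ Finset.Icc 1 n, s j * ∑ i ∈ Finset.Icc 1 (j - 1), s i := by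
  induction n with
  | zero => simp
  | succ n ih =>
    simp only [Finset.sum_Icc_succ_top (Nat.le_add_left 1 n), Nat.add_sub_cancel]
    nlinarith [h0 (n+1) (by omega), h1 (n+1) (by omega)]

lemma aux_anti (f f' : ℝ → ℝ) (hf : ∀ t, 0 ≤ t → HasDerivAt f (f' t) t)
    (h : ∀ t, 0 ≤ t → f' t ≤ 0) (t : ℝ) (ht : 0 ≤ t) : f t ≤ f 0 := by
  have : AntitoneOn f (Set.Ici 0) := by
    apply antitoneOn_of_deriv_nonpos (convex_Ici 0)
    · intro u hu
      exact (hf u hu).continuousAt.continuousWithinAt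
    · intro u hu
      rw [interior_Ici] at hu
      exact (hf u (le_of_lt hu)).differentiableAt.differentiableWithinAt
    · intro u hu
      rw [interior_Ici] at hu
      rw [(hf u (le_of_lt hu)).deriv]
      exact h u (le_of_lt hu)
  exact this (by simp) ht ht

lemma aux_pow (α : ℝ) (hα0 : 0 ≤ α) (hα : α < 1) (n : ℕ) :
    ∑ j ∈ Finset.Icc 1 n, (j : ℝ) ^ (-α) ≤ (n : ℝ) ^ (1 - α) / (1 - α) := by
  have h1 : 0 < 1 - α := by linarith
  induction n with
  | zero => simp [Real.zero_rpow h1.ne']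
  | succ n ih =>
    rw [Finset.sum_Icc_succ_top (Nat.le_add_left 1 n)]
    have hn : (0:ℝ) < ((n + 1 : ℕ) : ℝ) := by positivity
    have hN : ((n + 1 : ℕ) : ℝ) = n + 1 := by push_cast; ring
    set N : ℝ := ((n + 1 : ℕ) : ℝ)
    have hN1 : (1:ℝ) ≤ N := by rw [hN]; have : (0:ℝ) ≤ n := by positivity
                               linarith
    have hb := rpow_one_add_le_one_add_mul_self (s := -(1/N)) (p := 1 - α)
      (by rw [neg_le_neg_iff, div_le_one hn]; exact hN1) h1.le (by linarith)
    have hnn : (n : ℝ) = N * (1 + -(1/N)) := by field_simp; linarith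
    have hs : 0 ≤ 1 + -(1/N) := by
      have : 1/N ≤ 1 := by rw [div_le_one hn]; exact hN1
      linarith
    rw [hnn, Real.mul_rpow hn.le hs] at ih
    have hp : N ^ (1 - α) = N * N ^ (-α) := by
      rw [sub_eq_add_neg, Real.rpow_add hn, Real.rpow_one]
    have hpp : 0 < N ^ (-α) := Real.rpow_pos_of_pos hn _
    have h2 : N ^ (1 - α) * (1 + -(1/N)) ^ (1-α) / (1-α) ≤
       N ^ (1 - α) * (1 + (1-α) * -(1/N)) / (1-α) := by gcongr
    have h3 : N ^ (1 - α) * (1 + (1-α) * -(1/N)) / (1-α) = N ^ (1 - α)/(1-α) - N ^ (-α) := by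
      rw [hp]; field_simp; ring
    linarith

lemma aux_main (α ε : ℝ)
    (hα0 : 0 ≤ α) (hε0 : 0 < ε) (hε1 : ε ≤ 1)
    (x : ℕ → ℝ → ℝ)
    (hinit : ∀ k, 1 ≤ k → x k 0 = ε * (k : ℝ) ^ (-α))
    (hpos : ∀ k, 1 ≤ k → ∀ t : ℝ, 0 ≤ t → 0 < x k t)
    (hode : ∀ k, 1 ≤ k → ∀ t : ℝ, 0 ≤ t →
      HasDerivAt (x k) (x k t * ∑ j ∈ Finset.Icc 1 (k - 1), x j t * Gam x j t ^ 2) t)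
    (t : ℝ) (ht : 0 ≤ t) (k : ℕ) (hk : 1 ≤ k) :
        x k t ≤ (ε / (k : ℝ) ^ α) *
          (1 + (Real.exp (5 * t / 2) - 1) * ε *
            ∑ j ∈ Finset.Icc 1 (k - 1), (j : ℝ) ^ (-α)) ^ ((2 : ℝ) / 5) := by
  set s : ℕ → ℝ → ℝ := fun j t => x j t * Gam x j t ^ 2 with hs
  set S : ℕ → ℝ → ℝ := fun n t => ∑ j ∈ Finset.Icc 1 n, s j t with hS
  have hode' : ∀ k, 1 ≤ k → ∀ t : ℝ, 0 ≤ t → HasDerivAt (x k) (x k t * S (k-1) t) t := hode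
  have s0 : ∀ t, 0 ≤ t → ∀ j, 1 ≤ j → 0 ≤ s j t := by
    intro t ht j hj
    have := hpos j hj t ht
    simp only [hs]; positivity
  have S0 : ∀ t, 0 ≤ t → ∀ n, 0 ≤ S n t := by
    intro t ht n
    exact Finset.sum_nonneg fun j hj => s0 t ht j (Finset.mem_Icc.1 hj).1
  have hmono : ∀ j, 1 ≤ j → ∀ t, 0 ≤ t → x j 0 ≤ x j t := by
    intro j hj t ht
    have := aux_anti (fun t => - x j t) _ (fun t ht => (hode' j hj t ht).neg)
      (fun t ht => by
        have := mul_nonneg (hpos j hj t ht).le (S0 t ht (j-1))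
        linarith) t ht
    simpa using this
  have hx01 : ∀ j, 1 ≤ j → x j 0 ≤ 1 := by
    intro j hj
    rw [hinit j hj]
    have : (j:ℝ) ^ (-α) ≤ 1 :=
      Real.rpow_le_one_of_one_le_of_nonpos (by exact_mod_cast hj) (by linarith)
    have h2 : 0 ≤ (j:ℝ) ^ (-α) := by positivity
    nlinarith
  have s_eq : ∀ j, 1 ≤ j → ∀ t, 0 ≤ t → s j t = x j 0 ^ 6 * ((x j t) ^ 5)⁻¹ := by
    intro j hj t ht
    have := hpos j hj t ht
    simp only [hs, Gam]; field_simp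
  have s1 : ∀ t, 0 ≤ t → ∀ j, 1 ≤ j → s j t ≤ 1 := by
    intro t ht j hj
    have h := hpos j hj t ht
    have h0 := hpos j hj 0 le_rfl
    rw [s_eq j hj t ht, ← div_eq_mul_inv, div_le_one (by positivity)]
    calc x j 0 ^ 6 = x j 0 * x j 0 ^ 5 := by ring
      _ ≤ 1 * x j t ^ 5 := by
        gcongr
        · exact hx01 j hj
        · exact hmono j hj t ht
      _ = _ := one_mul _
  have ds : ∀ j, 1 ≤ j → ∀ t, 0 ≤ t → HasDerivAt (s j) (-5 * (s j t * S (j-1) t)) t := by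
    intro j hj t ht
    have h := hpos j hj t ht
    have h1 := hode' j hj t ht
    have hG : HasDerivAt (fun t => x j 0 / x j t) _ t := (hasDerivAt_const t (x j 0)).div h1 h.ne'
    have h2 := h1.mul ((hG.pow 3).pow 2)
    refine h2.congr_deriv ?_
    simp only [hs, Gam, Pi.pow_apply]
    norm_num
    field_simp
    ring
  have dS : ∀ n, ∀ t, 0 ≤ t →
      HasDerivAt (S n) (∑ j ∈ Finset.Icc 1 n, -5 * (s j t * S (j-1) t)) t := by
    intro n t ht
    exact HasDerivAt.fun_sum fun j hj => ds j (Finset.mem_Icc.1 hj).1 t ht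
  have hk0 := hpos k hk 0 le_rfl
  set w : ℝ → ℝ := fun t => (x k t / x k 0) ^ ((5:ℝ)/2) with hw
  have w0 : w 0 = 1 := by simp [hw, div_self hk0.ne']
  have wpos : ∀ t, 0 ≤ t → 0 < w t := fun t ht => Real.rpow_pos_of_pos
    (div_pos (hpos k hk t ht) hk0) _
  have dw : ∀ t, 0 ≤ t → HasDerivAt w (5/2 * S (k-1) t * w t) t := by
    intro t ht
    have h := hpos k hk t ht
    have hq : 0 < x k t / x k 0 := div_pos h hk0
    have := ((hode' k hk t ht).div_const (x k 0)).rpow_const (p := (5:ℝ)/2) (Or.inl hq.ne')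
    refine this.congr_deriv ?_
    simp only [hw]
    rw [Real.rpow_sub_one hq.ne']
    field_simp
  have dexp : ∀ c t : ℝ, HasDerivAt (fun t => Real.exp (c * t)) (c * Real.exp (c * t)) t := by
    intro c t
    have := ((hasDerivAt_id t).const_mul c).exp
    refine this.congr_deriv ?_
    simp; ring
  set A := S (k-1) 0 with hA
  have step1 : ∀ t, 0 ≤ t → S (k-1) t * w t ≤ A * Real.exp (5/2 * t) := by
    intro t ht
    have := aux_anti (fun t => S (k-1) t * w t * Real.exp (-(5/2) * t)) _
      (fun t ht => ((dS (k-1) t ht).mul (dw t ht)).mul (dexp (-(5/2)) t))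
      (fun t ht => by
        have h1 := aux_sum (fun j => s j t) (s0 t ht) (s1 t ht) (k-1)
        have h2 := wpos t ht
        have h3 := Real.exp_pos (-(5/2) * t)
        rw [← Finset.mul_sum]
        change (S (k-1) t)^2 - S (k-1) t ≤ 2 * ∑ j ∈ Finset.Icc 1 (k-1), s j t * S (j-1) t at h1
        have h4 := mul_nonneg (sub_nonneg.2 h1) (mul_pos h2 h3).le
        simp only [Pi.mul_apply]
        nlinarith) t ht
    simp only [w0, mul_zero, Real.exp_zero, mul_one] at this
    rw [neg_mul, Real.exp_neg, ← div_eq_mul_inv, div_le_iff₀ (Real.exp_pos _)] at this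
    exact this
  have step2 : w t ≤ 1 + (Real.exp (5 * t / 2) - 1) * A := by
    have := aux_anti (fun t => w t - A * Real.exp (5/2 * t)) _
      (fun t ht => (dw t ht).sub ((dexp (5/2) t).const_mul A))
      (fun t ht => by
        have := step1 t ht
        linarith) t ht
    simp only [w0, mul_zero, Real.exp_zero, mul_one] at this
    rw [show 5 * t / 2 = 5/2 * t by ring]
    linarith
  have hAe : A = ε * ∑ j ∈ Finset.Icc 1 (k - 1), (j : ℝ) ^ (-α) := by
    rw [hA, Finset.mul_sum]
    apply Finset.sum_congr rfl
    intro j hj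
    have hj := (Finset.mem_Icc.1 hj).1
    have h0 := hpos j hj 0 le_rfl
    rw [s_eq j hj 0 le_rfl, ← hinit j hj]
    field_simp
  rw [mul_assoc, ← hAe]
  have hq : 0 < x k t / x k 0 := div_pos (hpos k hk t ht) hk0
  have h5 := Real.rpow_le_rpow (wpos t ht).le step2 (z := (2:ℝ)/5) (by norm_num)
  simp only [hw] at h5
  rw [← Real.rpow_mul hq.le, show (5:ℝ)/2 * (2/5) = 1 by norm_num, Real.rpow_one,
    div_le_iff₀ hk0, hinit k hk, Real.rpow_neg (by positivity)] at h5
  rw [div_eq_mul_inv, mul_comm]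
  exact h5

lemma aux_bound (α ε : ℝ)
    (hα0 : 0 ≤ α) (hα : α < 1) (hε0 : 0 < ε) (hε1 : ε ≤ 1) (t : ℝ) (ht : 0 ≤ t) (k : ℕ) (hk : 1 ≤ k) :
    (ε / (k : ℝ) ^ α) *
          (1 + (Real.exp (5 * t / 2) - 1) * ε *
            ∑ j ∈ Finset.Icc 1 (k - 1), (j : ℝ) ^ (-α)) ^ ((2 : ℝ) / 5) ≤
     (1 + (Real.exp (5 * t / 2) - 1) / (1 - α)) ^ ((2 : ℝ) / 5) * (k : ℝ) ^ (-((7 * α - 2) / 5)) := by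
  have h1 : 0 < 1 - α := by linarith
  have hk1 : (1:ℝ) ≤ k := by exact_mod_cast hk
  have hk0 : (0:ℝ) < k := by linarith
  have hC : 0 ≤ Real.exp (5 * t / 2) - 1 := by
    have := Real.one_le_exp (show 0 ≤ 5 * t / 2 by positivity)
    linarith
  set C := Real.exp (5 * t / 2) - 1
  have hs := aux_pow α hα0 hα (k-1)
  have hs0 : 0 ≤ ∑ j ∈ Finset.Icc 1 (k - 1), (j : ℝ) ^ (-α) :=
    Finset.sum_nonneg fun j _ => by positivity
  have hle : (((k - 1 : ℕ) : ℝ)) ^ (1 - α) ≤ (k:ℝ) ^ (1 - α) := by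
    apply Real.rpow_le_rpow (by positivity) _ h1.le
    exact_mod_cast Nat.sub_le k 1
  have hs' : ∑ j ∈ Finset.Icc 1 (k - 1), (j : ℝ) ^ (-α) ≤ (k:ℝ) ^ (1 - α) / (1 - α) :=
    hs.trans (by gcongr)
  set T := ∑ j ∈ Finset.Icc 1 (k - 1), (j : ℝ) ^ (-α)
  have hone : 1 ≤ (k:ℝ) ^ (1 - α) := Real.one_le_rpow hk1 h1.le
  have hb : 1 + C * ε * T ≤ (1 + C / (1 - α)) * (k:ℝ) ^ (1 - α) := by
    have : C * ε * T ≤ C * 1 * ((k:ℝ) ^ (1 - α) / (1 - α)) := by gcongr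
    have e : C * 1 * ((k:ℝ) ^ (1 - α) / (1 - α)) = C / (1 - α) * (k:ℝ) ^ (1 - α) := by ring
    rw [e] at this
    linarith
  have hD : 0 ≤ 1 + C / (1 - α) := by positivity
  calc ε / (k : ℝ) ^ α * (1 + C * ε * T) ^ ((2 : ℝ) / 5)
      ≤ 1 / (k : ℝ) ^ α * ((1 + C / (1 - α)) * (k:ℝ) ^ (1 - α)) ^ ((2 : ℝ) / 5) := by
        gcongr
    _ = (1 + C / (1 - α)) ^ ((2 : ℝ) / 5) * (k : ℝ) ^ (-((7 * α - 2) / 5)) := by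
        rw [Real.mul_rpow hD (by positivity), ← Real.rpow_mul hk0.le, one_div,
          ← Real.rpow_neg hk0.le, mul_left_comm, ← Real.rpow_add hk0]
        congr 2
        ring

/-- Fix `2/7 ≤ α < 1` and `0 < ε ≤ 1`.  Let `x_k : [0,∞) → (0,∞)`,
`k = 1, 2, …`, be differentiable functions with `x_k(0) = ε k^(-α)`, satisfying for every
`k ≥ 1` and `t ≥ 0` the triangular ODE system
`x_k'(t) = x_k(t) Σ_{j=1}^{k-1} x_j(t) Γ_j(t)²` (empty sum for `k = 1`), where
`Γ_j(t) = (x_j(0)/x_j(t))³`.  Then for every `t > 0` and `k ≥ 2`,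
`x_k(t) ≤ (ε/k^α) (1 + (e^{5t/2} - 1) ε Σ_{j=1}^{k-1} j^{-α})^{2/5}`.
In particular, for every fixed `t > 0` the family `{x_k(t)}` is bounded,
and if `α > 2/7` then `x_k(t) → 0` as `k → ∞`. -/
theorem flattened_cascade_decay (α ε : ℝ)
    (hα0 : 2 / 7 ≤ α) (hα : α < 1) (hε0 : 0 < ε) (hε1 : ε ≤ 1)
    (x : ℕ → ℝ → ℝ)
    (hinit : ∀ k, 1 ≤ k → x k 0 = ε * (k : ℝ) ^ (-α))
    (hpos : ∀ k, 1 ≤ k → ∀ t : ℝ, 0 ≤ t → 0 < x k t)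
    (hode : ∀ k, 1 ≤ k → ∀ t : ℝ, 0 ≤ t →
      HasDerivAt (x k) (x k t * ∑ j ∈ Finset.Icc 1 (k - 1), x j t * Gam x j t ^ 2) t) :
    (∀ t : ℝ, 0 < t → ∀ k, 2 ≤ k →
        x k t ≤ (ε / (k : ℝ) ^ α) *
          (1 + (Real.exp (5 * t / 2) - 1) * ε *
            ∑ j ∈ Finset.Icc 1 (k - 1), (j : ℝ) ^ (-α)) ^ ((2 : ℝ) / 5))
    ∧ (∀ t : ℝ, 0 < t → ∃ M : ℝ, ∀ k, 1 ≤ k → x k t ≤ M)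
    ∧ (2 / 7 < α → ∀ t : ℝ, 0 < t → Tendsto (fun k => x k t) atTop (nhds 0)) := by
  have hα' : 0 ≤ α := by linarith
  have hm := aux_main α ε hα' hε0 hε1 x hinit hpos hode
  refine ⟨fun t ht k hk => hm t ht.le k (by omega), fun t ht => ?_, fun hα2 t ht => ?_⟩
  · refine ⟨(1 + (Real.exp (5 * t / 2) - 1) / (1 - α)) ^ ((2 : ℝ) / 5), fun k hk => ?_⟩
    refine ((hm t ht.le k hk).trans (aux_bound α ε hα' hα hε0 hε1 t ht.le k hk)).trans ?_
    have h1 : 0 < 1 - α := by linarith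
    have hC : 0 ≤ Real.exp (5 * t / 2) - 1 := by
      have := Real.one_le_exp (show 0 ≤ 5 * t / 2 by positivity)
      linarith
    apply mul_le_of_le_one_right (by positivity)
    exact Real.rpow_le_one_of_one_le_of_nonpos (by exact_mod_cast hk) (by linarith)
  · have h2 : Tendsto (fun k : ℕ => (1 + (Real.exp (5 * t / 2) - 1) / (1 - α)) ^ ((2 : ℝ) / 5) *
        (k : ℝ) ^ (-((7 * α - 2) / 5))) atTop (nhds 0) := by
      have := ((tendsto_rpow_neg_atTop (y := (7 * α - 2) / 5) (by linarith)).comp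
        tendsto_natCast_atTop_atTop).const_mul
          ((1 + (Real.exp (5 * t / 2) - 1) / (1 - α)) ^ ((2 : ℝ) / 5))
      simpa using this
    refine tendsto_of_tendsto_of_tendsto_of_le_of_le' tendsto_const_nhds h2 ?_ ?_
    · filter_upwards [eventually_ge_atTop 1] with k hk
      exact (hpos k hk t ht.le).le
    · filter_upwards [eventually_ge_atTop 1] with k hk
      exact (hm t ht.le k hk).trans (aux_bound α ε hα' hα hε0 hε1 t ht.le k hk)
end
end

section
/- Let Lambda : (0,1] -> (0,infty) be C^1 and nonincreasing and set Q_* := sup_{Gamma in (0,1]} ( -3 Gamma Lambda'(Gamma)/Lambda(Gamma) ); assume Q_* < 5. Fix epsilon > 0 and 0 < alpha < 1. Let x_k : [0,infty) -> (0,infty), k = 1, 2, 3, ..., be differentiable, nondecreasing functions with x_k(0) = epsilon k^{-alpha} (so that Gamma_j(t) := (x_j(0)/x_j(t))^3 lies in (0,1]), satisfying for every k >= 1 and t >= 0 the triangular ODE system x_k'(t) = x_k(t) Sum_{j=1}^{k-1} x_j(t) Gamma_j(t)^2 Lambda(Gamma_j(t)) (empty sum = 0 for k = 1). Then for every t > 0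 and every k >= 2, x_k(t) <= (epsilon / k^alpha) ( 1 + (e^{(5 - Q_*) Lambda(1) epsilon t / 2} - 1) Sum_{j=1}^{k-1} j^{-alpha} )^{2/(5 - Q_*)}. In particular, if alpha > 2/(7 - Q_*), then for every fixed t > 0, x_k(t) -> 0 as k -> infty. -/
noncomputable section

open Real Set Finset Filter

lemma aux_step (u v u' v' : ℝ → ℝ) (β : ℝ) (hβ0 : 0 ≤ β) (hβ1 : β ≤ 1)
    (hu : ∀ t, 0 ≤ t → HasDerivAt u (u' t) t) (hv : ∀ t, 0 ≤ t → HasDerivAt v (v' t) t)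
    (hu0 : u 0 = 0) (hv0 : v 0 = 0) (hupos : ∀ t, 0 ≤ t → 0 ≤ u t)
    (hu' : ∀ t, 0 ≤ t → 0 ≤ u' t)
    (hle : ∀ t, 0 ≤ t → v' t ≤ β * u' t * Real.exp (-2 * u t)) (t : ℝ) (ht : 0 ≤ t) :
    Real.exp (v t) ≤ 1 + β * (1 - Real.exp (-u t)) := by
  have hR : ∀ t, 0 ≤ t → 1 ≤ 1 + β * (1 - Real.exp (-u t)) := by
    intro t ht
    have : Real.exp (-u t) ≤ 1 := Real.exp_le_one_iff.2 (by linarith [hupos t ht])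
    nlinarith
  have hH : ∀ t, 0 ≤ t → HasDerivAt
      (fun t => Real.log (1 + β * (1 - Real.exp (-u t))) - v t)
      ((β * (Real.exp (-u t) * u' t)) / (1 + β * (1 - Real.exp (-u t))) - v' t) t := by
    intro t ht
    have h1 : HasDerivAt (fun t => 1 + β * (1 - Real.exp (-u t)))
        (β * -(Real.exp (-u t) * -u' t)) t := ((((hu t ht).neg.exp).const_sub 1).const_mul β).const_add 1
    have h2 := (h1.log (by have := hR t ht; linarith)).sub (hv t ht)
    refine h2.congr_deriv ?_
    ring
  have hmono : MonotoneOn (fun t => Real.log (1 + β * (1 - Real.exp (-u t))) - v t)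
      (Ici (0 : ℝ)) := by
    apply monotoneOn_of_deriv_nonneg (convex_Ici 0)
    · intro t ht
      exact (hH t ht).continuousAt.continuousWithinAt
    · intro t ht
      rw [interior_Ici] at ht
      exact (hH t (le_of_lt ht)).differentiableAt.differentiableWithinAt
    · intro t ht
      rw [interior_Ici] at ht
      have ht : 0 ≤ t := le_of_lt ht
      rw [(hH t ht).deriv]
      have hE : 0 < Real.exp (-u t) := Real.exp_pos _
      have hE1 : Real.exp (-u t) ≤ 1 := Real.exp_le_one_iff.2 (by linarith [hupos t ht])
      have h2 : Real.exp (-2 * u t) = Real.exp (-u t) * Real.exp (-u t) := by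
        rw [← Real.exp_add]; ring_nf
      have hl := hle t ht
      rw [h2] at hl
      have hRR := hR t ht
      have hu'' := hu' t ht
      rw [sub_nonneg]
      refine hl.trans ?_
      rw [le_div_iff₀ (by linarith)]
      set e := Real.exp (-u t)
      have key : e * (1 + β * (1 - e)) ≤ 1 := by
        nlinarith [mul_nonneg (mul_nonneg hE.le (sub_nonneg.2 hE1)) (sub_nonneg.2 hβ1), sq_nonneg (1 - e)]
      have hn : 0 ≤ β * (e * u' t) := by positivity
      nlinarith [mul_le_mul_of_nonneg_left key hn]
  have h := hmono (Set.self_mem_Ici) (Set.mem_Ici.2 ht) ht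
  simp only [hu0, hv0] at h
  simp at h
  have hpos : 0 < 1 + β * (1 - Real.exp (-u t)) := by linarith [hR t ht]
  calc Real.exp (v t) ≤ Real.exp (Real.log (1 + β * (1 - Real.exp (-u t)))) := Real.exp_le_exp.2 h
    _ = _ := Real.exp_log hpos

lemma aux_G (Λ Λ' : ℝ → ℝ)
    (hΛpos : ∀ Γ ∈ Ioc (0 : ℝ) 1, 0 < Λ Γ)
    (hΛderiv : ∀ Γ ∈ Ioc (0 : ℝ) 1, HasDerivWithinAt Λ (Λ' Γ) (Ioc (0 : ℝ) 1) Γ)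
    (Q : ℝ) (hQ : ∀ Γ ∈ Ioc (0 : ℝ) 1, -3 * Γ * Λ' Γ / Λ Γ ≤ Q) :
    MonotoneOn (fun Γ => Λ Γ * Γ ^ (Q / 3)) (Ioc (0 : ℝ) 1) := by
  have hd : ∀ Γ ∈ Ioc (0 : ℝ) 1, HasDerivWithinAt (fun Γ => Λ Γ * Γ ^ (Q / 3))
      (Λ' Γ * Γ ^ (Q / 3) + Λ Γ * (Q / 3 * Γ ^ (Q / 3 - 1))) (Ioc (0 : ℝ) 1) Γ := by
    intro Γ hΓ
    exact (hΛderiv Γ hΓ).mul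
      (Real.hasDerivAt_rpow_const (Or.inl hΓ.1.ne')).hasDerivWithinAt
  apply monotoneOn_of_hasDerivWithinAt_nonneg (convex_Ioc 0 1)
    (f' := fun Γ => Λ' Γ * Γ ^ (Q / 3) + Λ Γ * (Q / 3 * Γ ^ (Q / 3 - 1)))
  · intro Γ hΓ
    exact (hd Γ hΓ).continuousWithinAt
  · intro Γ hΓ
    exact (hd Γ (interior_subset hΓ)).mono interior_subset
  · intro Γ hΓ
    have hΓ := interior_subset hΓ
    have h0 : 0 < Γ := hΓ.1
    have h := hQ Γ hΓ
    rw [div_le_iff₀ (hΛpos Γ hΓ)] at h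
    have e : Γ ^ (Q / 3) = Γ ^ (Q / 3 - 1) * Γ := by
      rw [← Real.rpow_add_one h0.ne']; ring_nf
    rw [e]
    have hp : 0 < Γ ^ (Q / 3 - 1) := Real.rpow_pos_of_pos h0 _
    have : 0 ≤ Γ ^ (Q / 3 - 1) * (Q * Λ Γ + 3 * Γ * Λ' Γ) := by
      apply mul_nonneg hp.le; linarith
    nlinarith

lemma aux_sum_s16 (α : ℝ) (hα0 : 0 < α) (hα : α < 1) (n : ℕ) :
    ∑ j ∈ Finset.Icc 1 n, (j : ℝ) ^ (-α) ≤ (n : ℝ) ^ (1 - α) / (1 - α) := by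
  induction n with
  | zero => simp [Real.zero_rpow (by linarith : (1 - α) ≠ 0)]
  | succ n ih =>
    rw [Finset.sum_Icc_succ_top (by omega)]
    have h1 : (0 : ℝ) < ((n + 1 : ℕ) : ℝ) := by positivity
    set m : ℝ := ((n + 1 : ℕ) : ℝ) with hm
    have hn : (n : ℝ) = m * (1 + (-1 / m)) := by
      field_simp; rw [hm]; push_cast; ring
    have h1m : 1 ≤ m := by rw [hm]; push_cast; linarith [(Nat.cast_nonneg n : (0:ℝ) ≤ n)]
    have hs : -1 ≤ -1 / m := by rw [le_div_iff₀ h1]; linarith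
    have hB := rpow_one_add_le_one_add_mul_self hs (by linarith : 0 ≤ 1 - α) (by linarith)
    have e1 : (n : ℝ) ^ (1 - α) ≤ m ^ (1 - α) - (1 - α) * m ^ (-α) := by
      rw [hn, Real.mul_rpow h1.le (by linarith)]
      have e2 : m ^ (1 - α) = m ^ (-α) * m := by
        rw [← Real.rpow_add_one h1.ne']; ring_nf
      calc _ ≤ m ^ (1 - α) * (1 + (1 - α) * (-1 / m)) := by gcongr
        _ = _ := by rw [e2]; field_simp; ring
    have h2 : (0 : ℝ) < 1 - α := by linarith
    calc _ ≤ (n : ℝ) ^ (1 - α) / (1 - α) + m ^ (-α) := by linarith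
      _ ≤ (m ^ (1 - α) - (1 - α) * m ^ (-α)) / (1 - α) + m ^ (-α) := by gcongr
      _ = _ := by field_simp; ring


/-- Let `Λ : (0,1] → (0,∞)` be `C¹` (with derivative `Λ'`) and
nonincreasing, and let `Q_* = sup_{Γ ∈ (0,1]} (-3 Γ Λ'(Γ)/Λ(Γ))`; assume `Q_* < 5`.
Fix `ε > 0` and `0 < α < 1`.  Let `x_k : [0,∞) → (0,∞)`, `k = 1, 2, …`, be differentiable,
nondecreasing functions with `x_k(0) = ε k^(-α)`, satisfying the triangular ODE system
`x_k'(t) = x_k(t) Σ_{j=1}^{k-1} x_j(t) Γ_j(t)² Λ(Γ_j(t))`.  Then for every `t > 0` and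
`k ≥ 2`, `x_k(t) ≤ (ε/k^α)(1 + (e^{(5-Q_*)Λ(1)εt/2} - 1) Σ_{j=1}^{k-1} j^{-α})^{2/(5-Q_*)}`.
In particular, if `α > 2/(7 - Q_*)` then for every fixed `t > 0`, `x_k(t) → 0` as
`k → ∞`. -/
theorem frozen_profile_cascade_decay (Λ Λ' : ℝ → ℝ)
    (hΛpos : ∀ Γ ∈ Ioc (0 : ℝ) 1, 0 < Λ Γ)
    (hΛderiv : ∀ Γ ∈ Ioc (0 : ℝ) 1, HasDerivWithinAt Λ (Λ' Γ) (Ioc (0 : ℝ) 1) Γ)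
    (hΛ'cont : ContinuousOn Λ' (Ioc (0 : ℝ) 1))
    (hΛmono : AntitoneOn Λ (Ioc (0 : ℝ) 1))
    (Qstar : ℝ)
    (hQ : IsLUB ((fun Γ => -3 * Γ * Λ' Γ / Λ Γ) '' Ioc (0 : ℝ) 1) Qstar)
    (hQ5 : Qstar < 5)
    (α ε : ℝ) (hε : 0 < ε) (hα0 : 0 < α) (hα : α < 1)
    (x : ℕ → ℝ → ℝ)
    (hinit : ∀ k, 1 ≤ k → x k 0 = ε * (k : ℝ) ^ (-α))
    (hpos : ∀ k, 1 ≤ k → ∀ t : ℝ, 0 ≤ t → 0 < x k t)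
    (hmono : ∀ k, 1 ≤ k → MonotoneOn (x k) (Ici (0 : ℝ)))
    (hode : ∀ k, 1 ≤ k → ∀ t : ℝ, 0 ≤ t →
      HasDerivAt (x k)
        (x k t * ∑ j ∈ Finset.Icc 1 (k - 1), x j t * Gam x j t ^ 2 * Λ (Gam x j t)) t) :
    (∀ t : ℝ, 0 < t → ∀ k, 2 ≤ k →
        x k t ≤ (ε / (k : ℝ) ^ α) *
          (1 + (Real.exp ((5 - Qstar) * Λ 1 * ε * t / 2) - 1) *
            ∑ j ∈ Finset.Icc 1 (k - 1), (j : ℝ) ^ (-α)) ^ ((2 : ℝ) / (5 - Qstar)))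
    ∧ (2 / (7 - Qstar) < α →
        ∀ t : ℝ, 0 < t → Tendsto (fun k => x k t) atTop (nhds 0)) := by
  have hp : 0 < 5 - Qstar := by linarith
  obtain ⟨p, hpdef⟩ : ∃ p, p = 5 - Qstar := ⟨_, rfl⟩
  have hQp : Qstar = 5 - p := by linarith
  rw [← hpdef] at hp
  have hG := aux_G Λ Λ' hΛpos hΛderiv Qstar
    (fun Γ hΓ => hQ.1 (Set.mem_image_of_mem _ hΓ))
  have hb : ∀ k : ℕ, 1 ≤ k → 0 < (k : ℝ) ^ (-α) := fun k hk =>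
    Real.rpow_pos_of_pos (by exact_mod_cast hk) _
  have hΛ1 : 0 < Λ 1 := hΛpos 1 ⟨one_pos, le_rfl⟩
  have h00 : ∀ k, 1 ≤ k → 0 < x k 0 := fun k hk => hpos k hk 0 le_rfl
  obtain ⟨S, hS⟩ : ∃ S : ℕ → ℝ → ℝ, S = fun k t => Real.log (x k t / x k 0) := ⟨_, rfl⟩
  obtain ⟨f, hf⟩ : ∃ f : ℕ → ℝ → ℝ, f = fun j t => x j t * Gam x j t ^ 2 * Λ (Gam x j t) :=
    ⟨_, rfl⟩
  have hexpS : ∀ k, 1 ≤ k → ∀ t, 0 ≤ t → Real.exp (S k t) = x k t / x k 0 := by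
    intro k hk t ht
    rw [hS]; exact Real.exp_log (div_pos (hpos k hk t ht) (h00 k hk))
  have hS0 : ∀ k, 1 ≤ k → S k 0 = 0 := by
    intro k hk
    rw [hS]; simp [(h00 k hk).ne']
  have hSnn : ∀ k, 1 ≤ k → ∀ t, 0 ≤ t → 0 ≤ S k t := by
    intro k hk t ht
    rw [hS]
    apply Real.log_nonneg
    rw [le_div_iff₀ (h00 k hk), one_mul]
    exact hmono k hk Set.self_mem_Ici (Set.mem_Ici.2 ht) ht
  have hSd : ∀ k, 1 ≤ k → ∀ t, 0 ≤ t →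
      HasDerivAt (S k) (∑ j ∈ Finset.Icc 1 (k - 1), f j t) t := by
    intro k hk t ht
    have h := ((hode k hk t ht).div_const (x k 0)).log
      (div_pos (hpos k hk t ht) (h00 k hk)).ne'
    have hx := hpos k hk t ht
    have hx0 := h00 k hk
    rw [hS, hf]
    convert h using 1
    field_simp
  have hGam : ∀ k, 1 ≤ k → ∀ t, 0 ≤ t → Gam x k t = Real.exp (-3 * S k t) := by
    intro k hk t ht
    have : Real.exp (-3 * S k t) = (Real.exp (S k t))⁻¹ ^ 3 := by
      rw [← Real.exp_neg, ← Real.exp_nat_mul]; push_cast; ring_nf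
    rw [this, hexpS k hk t ht, inv_div]; rfl
  have hmem : ∀ k, 1 ≤ k → ∀ t, 0 ≤ t → Real.exp (-3 * S k t) ∈ Ioc (0 : ℝ) 1 := by
    intro k hk t ht
    exact ⟨Real.exp_pos _, Real.exp_le_one_iff.2 (by linarith [hSnn k hk t ht])⟩
  have hfpos : ∀ k, 1 ≤ k → ∀ t, 0 ≤ t → 0 < f k t := by
    intro k hk t ht
    have := hmem k hk t ht
    rw [hf]; simp only
    rw [hGam k hk t ht]
    exact mul_pos (mul_pos (hpos k hk t ht) (pow_pos this.1 2)) (hΛpos _ this)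
  have hfeq : ∀ k, 1 ≤ k → ∀ t, 0 ≤ t → f k t = ε * (k : ℝ) ^ (-α) * Real.exp (-p * S k t) *
      (Λ (Real.exp (-3 * S k t)) * Real.exp (-3 * S k t) ^ (Qstar / 3)) := by
    intro k hk t ht
    have h1 : x k t = ε * (k : ℝ) ^ (-α) * Real.exp (S k t) := by
      rw [hexpS k hk t ht, ← hinit k hk]; field_simp [(h00 k hk).ne']
    have h2 : Real.exp (-3 * S k t) ^ (Qstar / 3) = Real.exp (-Qstar * S k t) := by
      rw [← Real.exp_mul]; ring_nf
    have h3 : Real.exp (-p * S k t) * Real.exp (-Qstar * S k t)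
        = Real.exp (S k t) * Real.exp (-3 * S k t) ^ 2 := by
      rw [← Real.exp_nat_mul, ← Real.exp_add, ← Real.exp_add, hQp]; push_cast; ring_nf
    rw [hf]; simp only
    rw [hGam k hk t ht, h2, h1]
    linear_combination (-(ε * (k : ℝ) ^ (-α) * Λ (Real.exp (-3 * S k t)))) * h3
  -- increments
  obtain ⟨q, hq⟩ : ∃ q : ℕ → ℝ → ℝ, q = fun k t => p / 2 * (S (k + 1) t - S k t) := ⟨_, rfl⟩
  have hqd : ∀ k, 1 ≤ k → ∀ t, 0 ≤ t → HasDerivAt (q k) (p / 2 * f k t) t := by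
    intro k hk t ht
    have h := ((hSd (k + 1) (by omega) t ht).sub (hSd k hk t ht)).const_mul (p / 2)
    rw [hq]
    refine h.congr_deriv ?_
    obtain ⟨m, rfl⟩ : ∃ m, k = m + 1 := ⟨k - 1, by omega⟩
    simp only [Nat.add_sub_cancel]
    rw [Finset.sum_Icc_succ_top (by omega)]
    ring
  have hq0 : ∀ k, 1 ≤ k → q k 0 = 0 := by
    intro k hk
    rw [hq]; simp [hS0 k hk, hS0 (k + 1) (by omega)]
  have hqnn : ∀ k, 1 ≤ k → ∀ t, 0 ≤ t → 0 ≤ q k t := by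
    intro k hk t ht
    have hm : MonotoneOn (q k) (Ici (0 : ℝ)) := by
      apply monotoneOn_of_hasDerivWithinAt_nonneg (convex_Ici 0) (f' := fun t => p / 2 * f k t)
      · intro t ht
        exact (hqd k hk t ht).continuousAt.continuousWithinAt
      · intro t ht
        exact (hqd k hk t (interior_subset ht)).hasDerivWithinAt
      · intro t ht
        have := hfpos k hk t (interior_subset ht)
        positivity
    have := hm Set.self_mem_Ici (Set.mem_Ici.2 ht) ht
    rwa [hq0 k hk] at this
  have hstep : ∀ k, 1 ≤ k → ∀ t, 0 ≤ t → Real.exp (q (k + 1) t) ≤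
      1 + ((k + 1 : ℕ) : ℝ) ^ (-α) / (k : ℝ) ^ (-α) * (1 - Real.exp (-q k t)) := by
    intro k hk t ht
    have hbk := hb k hk
    have hbk1 := hb (k + 1) (by omega)
    apply aux_step (q k) (q (k + 1)) (fun t => p / 2 * f k t) (fun t => p / 2 * f (k + 1) t)
      (((k + 1 : ℕ) : ℝ) ^ (-α) / (k : ℝ) ^ (-α)) (by positivity) ?_ (hqd k hk)
      (hqd (k + 1) (by omega)) (hq0 k hk) (hq0 (k + 1) (by omega)) (hqnn k hk) ?_ ?_ t ht
    · rw [div_le_one hbk]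
      apply Real.rpow_le_rpow_of_nonpos (by exact_mod_cast hk) (by push_cast; linarith) (by linarith)
    · intro t ht
      have := hfpos k hk t ht
      positivity
    · intro t ht
      have hSS : S k t ≤ S (k + 1) t := by
        have := hqnn k hk t ht
        rw [hq] at this
        simp only at this
        have := nonneg_of_mul_nonneg_right this (by positivity)
        linarith
      have hGG := hG (hmem (k + 1) (by omega) t ht) (hmem k hk t ht)
        (Real.exp_le_exp.2 (by linarith))
      simp only at hGG
      rw [hfeq k hk t ht, hfeq (k + 1) (by omega) t ht]
      have hE : Real.exp (-p * S (k + 1) t) =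
          Real.exp (-p * S k t) * Real.exp (-2 * q k t) := by
        rw [← Real.exp_add, hq]; ring_nf
      rw [hE]
      set G1 := Λ (Real.exp (-3 * S (k + 1) t)) * Real.exp (-3 * S (k + 1) t) ^ (Qstar / 3)
      set G0 := Λ (Real.exp (-3 * S k t)) * Real.exp (-3 * S k t) ^ (Qstar / 3)
      calc _ ≤ p / 2 * (ε * ((k + 1 : ℕ) : ℝ) ^ (-α) *
            (Real.exp (-p * S k t) * Real.exp (-2 * q k t)) * G0) := by gcongr
        _ = _ := by field_simp
  -- first increment
  have hS1 : ∀ t, 0 ≤ t → S 1 t = 0 := by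
    intro t ht
    have hc : ∀ s, 0 ≤ s → HasDerivAt (S 1) 0 s := by
      intro s hs
      simpa using hSd 1 le_rfl s hs
    have := constant_of_has_deriv_right_zero (f := S 1) (a := 0) (b := t)
      (fun s hs => (hc s hs.1).continuousAt.continuousWithinAt)
      (fun s hs => (hc s hs.1).hasDerivWithinAt) t ⟨ht, le_rfl⟩
    rw [this, hS0 1 le_rfl]
  have hq1 : ∀ t, 0 ≤ t → q 1 t = p * Λ 1 * ε * t / 2 := by
    intro t ht
    have hc : ∀ s, 0 ≤ s → HasDerivAt (fun s => q 1 s - p * Λ 1 * ε / 2 * s) 0 s := by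
      intro s hs
      have h := (hqd 1 le_rfl s hs).sub ((hasDerivAt_id s).const_mul (p * Λ 1 * ε / 2))
      refine h.congr_deriv ?_
      rw [hfeq 1 le_rfl s hs, hS1 s hs]
      simp
      ring
    have := constant_of_has_deriv_right_zero (f := fun s => q 1 s - p * Λ 1 * ε / 2 * s)
      (a := 0) (b := t)
      (fun s hs => (hc s hs.1).continuousAt.continuousWithinAt)
      (fun s hs => (hc s hs.1).hasDerivWithinAt) t ⟨ht, le_rfl⟩
    simp only [hq0 1 le_rfl] at this
    linarith
  obtain ⟨z, hz⟩ : ∃ z : ℕ → ℝ → ℝ, z = fun k t => Real.exp (p / 2 * S k t) := ⟨_, rfl⟩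
  have hzq : ∀ k t, z (k + 1) t = z k t * Real.exp (q k t) := by
    intro k t
    rw [hz, hq]; simp only
    rw [← Real.exp_add]; ring_nf
  have hzpos : ∀ k t, 0 < z k t := by
    intro k t; rw [hz]; exact Real.exp_pos _
  have hz1 : ∀ t, 0 ≤ t → z 1 t = 1 := by
    intro t ht
    rw [hz]; simp [hS1 t ht]
  have hinc : ∀ t, 0 ≤ t → ∀ k, 1 ≤ k → z (k + 1) t - z k t ≤
      (Real.exp (p * Λ 1 * ε * t / 2) - 1) * (k : ℝ) ^ (-α) := by
    intro t ht k hk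
    induction k, hk using Nat.le_induction with
    | base => rw [hzq 1 t, hz1 t ht, hq1 t ht]; simp
    | succ k hk ih =>
      have hs := hstep k hk t ht
      have hbk := hb k hk
      have hbk1 := hb (k + 1) (by omega)
      have e1 : z (k + 1) t * Real.exp (-q k t) = z k t := by
        rw [hzq k t, mul_assoc, ← Real.exp_add]; simp
      rw [hzq (k + 1) t]
      calc z (k + 1) t * Real.exp (q (k + 1) t) - z (k + 1) t
          ≤ z (k + 1) t * (1 + ((k + 1 : ℕ) : ℝ) ^ (-α) / (k : ℝ) ^ (-α) *
            (1 - Real.exp (-q k t))) - z (k + 1) t := by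
            have := mul_le_mul_of_nonneg_left hs (hzpos (k + 1) t).le
            linarith
        _ = ((k + 1 : ℕ) : ℝ) ^ (-α) / (k : ℝ) ^ (-α) * (z (k + 1) t - z k t) := by
            rw [← e1]; ring
        _ ≤ ((k + 1 : ℕ) : ℝ) ^ (-α) / (k : ℝ) ^ (-α) *
            ((Real.exp (p * Λ 1 * ε * t / 2) - 1) * (k : ℝ) ^ (-α)) := by gcongr
        _ = _ := by field_simp
  have hzb : ∀ t, 0 ≤ t → ∀ n : ℕ, z (n + 1) t ≤
      1 + (Real.exp (p * Λ 1 * ε * t / 2) - 1) * ∑ j ∈ Finset.Icc 1 n, (j : ℝ) ^ (-α) := by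
    intro t ht n
    induction n with
    | zero => simp [hz1 t ht]
    | succ n ih =>
      rw [Finset.sum_Icc_succ_top (by omega)]
      have := hinc t ht (n + 1) (by omega)
      rw [mul_add]
      linarith
  rw [← hpdef]
  have hmain : ∀ t : ℝ, 0 < t → ∀ k, 2 ≤ k →
        x k t ≤ (ε / (k : ℝ) ^ α) *
          (1 + (Real.exp (p * Λ 1 * ε * t / 2) - 1) *
            ∑ j ∈ Finset.Icc 1 (k - 1), (j : ℝ) ^ (-α)) ^ ((2 : ℝ) / p) := by
    intro t ht k hk
    have hk1 : 1 ≤ k := by omega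
    have h := hzb t ht.le (k - 1)
    rw [Nat.sub_add_cancel hk1] at h
    have h1 : x k t = ε / (k : ℝ) ^ α * z k t ^ ((2 : ℝ) / p) := by
      have : z k t ^ ((2 : ℝ) / p) = Real.exp (S k t) := by
        rw [hz]; simp only
        rw [← Real.exp_mul]; congr 1; field_simp
      rw [this, hexpS k hk1 t ht.le, div_eq_mul_inv ε, ← Real.rpow_neg (by positivity),
        ← hinit k hk1]
      field_simp [(h00 k hk1).ne']
    rw [h1]
    have := hzpos k t
    gcongr
  refine ⟨hmain, ?_⟩
  intro hα2 t ht
  have hα1 : 0 < 1 - α := by linarith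
  have hC0 : 0 ≤ Real.exp (p * Λ 1 * ε * t / 2) - 1 := by
    have : 1 ≤ Real.exp (p * Λ 1 * ε * t / 2) := Real.one_le_exp (by positivity)
    linarith
  obtain ⟨C, hC⟩ : ∃ C, C = Real.exp (p * Λ 1 * ε * t / 2) - 1 := ⟨_, rfl⟩
  rw [← hC] at hC0
  have hbound : ∀ k : ℕ, 2 ≤ k → x k t ≤ ε * (1 + C / (1 - α)) ^ ((2 : ℝ) / p) *
      (k : ℝ) ^ (-(α - (1 - α) * (2 / p))) := by
    intro k hk
    have hk1 : 1 ≤ k := by omega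
    have hkpos : (0 : ℝ) < k := by positivity
    have hk1' : (1 : ℝ) ≤ k := by exact_mod_cast hk1
    refine (hmain t ht k hk).trans ?_
    rw [← hC]
    have hs := aux_sum_s16 α hα0 hα (k - 1)
    have hs2 : ((k - 1 : ℕ) : ℝ) ^ (1 - α) ≤ (k : ℝ) ^ (1 - α) := by
      apply Real.rpow_le_rpow (by positivity) (by exact_mod_cast Nat.sub_le k 1) hα1.le
    have hone : 1 ≤ (k : ℝ) ^ (1 - α) := Real.one_le_rpow hk1' hα1.le
    have hsn : 0 ≤ ∑ j ∈ Finset.Icc 1 (k - 1), (j : ℝ) ^ (-α) :=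
      Finset.sum_nonneg (fun j _ => by positivity)
    have hB : 1 + C * ∑ j ∈ Finset.Icc 1 (k - 1), (j : ℝ) ^ (-α) ≤
        (1 + C / (1 - α)) * (k : ℝ) ^ (1 - α) := by
      calc _ ≤ (k : ℝ) ^ (1 - α) + C * ((k : ℝ) ^ (1 - α) / (1 - α)) := by
            gcongr
            refine hs.trans ?_
            gcongr
        _ = _ := by ring
    calc _ ≤ ε / (k : ℝ) ^ α * ((1 + C / (1 - α)) * (k : ℝ) ^ (1 - α)) ^ ((2 : ℝ) / p) := by
          gcongr
      _ = _ := by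
          rw [Real.mul_rpow (by positivity) (by positivity), ← Real.rpow_mul hkpos.le,
            div_eq_mul_inv ε, ← Real.rpow_neg hkpos.le, neg_sub, sub_eq_add_neg ((1 - α) * (2 / p)) α,
            Real.rpow_add hkpos]
          ring
  have hexpo : 0 < α - (1 - α) * (2 / p) := by
    have h7 : 7 - Qstar = p + 2 := by linarith
    rw [h7, div_lt_iff₀ (by linarith)] at hα2
    have : α - (1 - α) * (2 / p) = (α * (p + 2) - 2) / p := by field_simp; ring
    rw [this]
    apply div_pos _ hp
    linarith
  have hlim : Tendsto (fun k : ℕ => ε * (1 + C / (1 - α)) ^ ((2 : ℝ) / p) *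
      (k : ℝ) ^ (-(α - (1 - α) * (2 / p)))) atTop (nhds 0) := by
    have := ((tendsto_rpow_neg_atTop hexpo).comp tendsto_natCast_atTop_atTop).const_mul
      (ε * (1 + C / (1 - α)) ^ ((2 : ℝ) / p))
    simpa using this
  refine tendsto_of_tendsto_of_tendsto_of_le_of_le' tendsto_const_nhds hlim ?_ ?_
  · filter_upwards [eventually_ge_atTop 1] with k hk using (hpos k hk t ht.le).le
  · filter_upwards [eventually_ge_atTop 2] with k hk using hbound k hk
end
end
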